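/- arXiv:2403.08595 — 2 statements merged into one kernel-verified Lean document; each statement's English description precedes it below -/
import Mathlib

section
/- Let D be a division ring whose center F contains at least four elements, let n be a positive integer, let ⋆ be an involution of the first kind on A = M_n(D), and let G be a non-central subnormal subgroup of GL_n(D) = A^×. Then the following are equivalent: (1) g + g^⋆ lies in the center of A for every g ∈ G; (2) x + x^⋆ lies in the center of A for every x ∈ A; (3) x·x^⋆ lies in the center of A for every x ∈ A; (4) g·g^⋆ lies in the center of A for every g ∈ G. -/
/-- A subgroup `G` of a group `Γ` is subnormal if there is a finite chain of
subgroups `G = G_r ⊴ G_{r-1} ⊴ ⋯ ⊴ G_0 = Γ` in which each term is a normal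
subgroup of the next. -/
def Subgroup.IsSubnormal' {Γ : Type*} [Group Γ] (G : Subgroup Γ) : Prop :=
  ∃ (r : ℕ) (c : Fin (r + 1) → Subgroup Γ), c 0 = G ∧ c (Fin.last r) = ⊤ ∧
    ∀ i : Fin r, c i.castSucc ≤ c i.succ ∧
      ∀ h ∈ c i.castSucc, ∀ g ∈ c i.succ, g * h * g⁻¹ ∈ c i.castSucc

/-- `SubnormalDepth r G`: there is a chain of length `r` from `G` up to the whole group, each
term normal in the next. -/
def SubnormalDepth {Γ : Type*} [Group Γ] : ℕ → Subgroup Γ → Prop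
  | 0, G => G = ⊤
  | r + 1, G => ∃ H, SubnormalDepth r H ∧ G ≤ H ∧ ∀ x ∈ G, ∀ y ∈ H, y * x * y⁻¹ ∈ G

/-- The iterated commutator `[[[x, mₖ], …], m₁]` for the list `m₁, …, mₖ`. -/
def iterCommutator {Γ : Type*} [Group Γ] : List Γ → Γ → Γ
  | [], x => x
  | m :: ms, x => iterCommutator ms x * m * (iterCommutator ms x)⁻¹ * m⁻¹

/-- The iterated difference operator `v ↦ v - m v m⁻¹` along a list of units. -/
def iterDiff {R : Type*} [Ring R] : List Rˣ → R → R
  | [], y => y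
  | m :: ms, y => iterDiff ms y - m * iterDiff ms y * (m⁻¹ : Rˣ)

theorem SubnormalDepth.iterCommutator_mem {Γ : Type*} [Group Γ] {r : ℕ} {G : Subgroup Γ}
    (hG : SubnormalDepth r G) (ms : List Γ) (hms : ∀ m ∈ ms, m ∈ G) (hlen : ms.length = r)
    (x : Γ) : iterCommutator ms x ∈ G := by
  induction r generalizing G ms with
  | zero => rw [SubnormalDepth] at hG; simp [hG]
  | succ r ih =>
    obtain ⟨H, hH, hle, hconj⟩ := hG
    match ms, hlen with
    | m :: ms, hlen =>
      have hw := ih hH ms (fun a ha => hle (hms a (by simp [ha]))) (by simpa using hlen)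
      exact G.mul_mem (hconj m (hms m (by simp)) _ hw) (G.inv_mem (hms m (by simp)))

open Polynomial in
/-- Polynomials whose `i`-th coefficient lies in `E * h ^ i`, for a subring `E` normalised
by `h`. -/
def twistedPolynomials {D : Type*} [DivisionRing D] (E : Subring D) (h : Dˣ)
    (hE : ∀ e ∈ E, (h : D) * e * (h⁻¹ : Dˣ) ∈ E) : Subring D[X] where
  carrier := {p | ∀ i, p.coeff i * ((h⁻¹ ^ i : Dˣ) : D) ∈ E}
  mul_mem' := by
    intro p q hp hq n
    have key : ∀ (i : ℕ), ∀ e ∈ E, ((h ^ i : Dˣ) : D) * e * ((h⁻¹ ^ i : Dˣ) : D) ∈ E := by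
      intro i
      induction i with
      | zero => simp
      | succ i ih =>
        intro e he
        have := hE _ (ih e he)
        rw [pow_succ', pow_succ h⁻¹]
        simpa only [Units.val_mul, mul_assoc] using this
    rw [coeff_mul, Finset.sum_mul]
    refine E.sum_mem fun x hx => ?_
    have hx' : x.1 + x.2 = n := by simpa using hx
    have := E.mul_mem (hp x.1) (key x.1 _ (hq x.2))
    have e : p.coeff x.1 * q.coeff x.2 * ((h⁻¹ ^ n : Dˣ) : D) =
        p.coeff x.1 * ((h⁻¹ ^ x.1 : Dˣ) : D) * (((h ^ x.1 : Dˣ) : D) *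
          (q.coeff x.2 * ((h⁻¹ ^ x.2 : Dˣ) : D)) * ((h⁻¹ ^ x.1 : Dˣ) : D)) := by
      have e1 : ((h⁻¹ ^ n : Dˣ) : D) = ((h⁻¹ ^ x.2 : Dˣ) : D) * ((h⁻¹ ^ x.1 : Dˣ) : D) := by
        rw [← Units.val_mul, ← pow_add, add_comm x.2, hx']
      have e2 : ((h⁻¹ ^ x.1 : Dˣ) : D) * ((h ^ x.1 : Dˣ) : D) = 1 := by
        rw [← Units.val_mul]; simp
      rw [e1]
      simp only [mul_assoc]
      rw [← mul_assoc ((h⁻¹ ^ x.1 : Dˣ) : D) ((h ^ x.1 : Dˣ) : D), e2, one_mul]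
    rw [e]; exact this
  one_mem' := by
    intro i
    rw [coeff_one]
    split_ifs with hi
    · subst hi; simp
    · simp
  add_mem' := by
    intro p q hp hq i
    rw [coeff_add, add_mul]
    exact E.add_mem (hp i) (hq i)
  zero_mem' := by intro i; simp
  neg_mem' := by
    intro p hp i
    rw [coeff_neg, neg_mul]
    exact E.neg_mem (hp i)

section twisted
open Polynomial

variable {D : Type*} [DivisionRing D] {E : Subring D} {h : Dˣ}
  {hE : ∀ e ∈ E, (h : D) * e * (h⁻¹ : Dˣ) ∈ E}

theorem C_mul_X_pow_mem_twistedPolynomials {c : D} {i : ℕ}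
    (hc : c * ((h⁻¹ ^ i : Dˣ) : D) ∈ E) : C c * X ^ i ∈ twistedPolynomials E h hE := by
  intro j
  rw [coeff_C_mul_X_pow]
  split_ifs with hj
  · subst hj; exact hc
  · simp

theorem C_mem_twistedPolynomials {c : D} (hc : c ∈ E) : C c ∈ twistedPolynomials E h hE := by
  have := C_mul_X_pow_mem_twistedPolynomials (hE := hE) (c := c) (i := 0) (by simpa using hc)
  simpa using this

theorem conj_pow_mem (hE : ∀ e ∈ E, (h : D) * e * (h⁻¹ : Dˣ) ∈ E) (i : ℕ) {e : D} (he : e ∈ E) :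
    ((h ^ i : Dˣ) : D) * e * ((h⁻¹ ^ i : Dˣ) : D) ∈ E := by
  induction i with
  | zero => simpa
  | succ i ih =>
    have := hE _ ih
    rw [pow_succ', pow_succ h⁻¹]
    simpa only [Units.val_mul, mul_assoc] using this

theorem twistedPolynomials_ore (hinv : ∀ e ∈ E, e⁻¹ ∈ E)
    (hE' : ∀ e ∈ E, ((h⁻¹ : Dˣ) : D) * e * h ∈ E)
    {p q : D[X]} (hp : p ∈ twistedPolynomials E h hE) (hq : q ∈ twistedPolynomials E h hE)
    (hp0 : p ≠ 0) (hq0 : q ≠ 0) :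
    ∃ A ∈ twistedPolynomials E h hE, ∃ B ∈ twistedPolynomials E h hE,
      A ≠ 0 ∧ B ≠ 0 ∧ p * B = q * A := by
  obtain ⟨N, hN⟩ : ∃ N, p.natDegree + q.natDegree ≤ N := ⟨_, le_rfl⟩
  induction N using Nat.strong_induction_on generalizing p q with
  | _ N ih =>
  wlog hpq : q.natDegree ≤ p.natDegree generalizing p q
  · obtain ⟨A, hA, B, hB, hA0, hB0, e⟩ :=
      this hq hp hq0 hp0 (by omega) (by omega)
    exact ⟨B, hB, A, hA, hB0, hA0, e.symm⟩
  set d := p.natDegree - q.natDegree with hd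
  set c := q.leadingCoeff⁻¹ * p.leadingCoeff with hc
  have hcE : C c * X ^ d ∈ twistedPolynomials E h hE := by
    apply C_mul_X_pow_mem_twistedPolynomials
    have h1 : q.leadingCoeff * ((h⁻¹ ^ q.natDegree : Dˣ) : D) ∈ E := hq _
    have h2 : p.leadingCoeff * ((h⁻¹ ^ p.natDegree : Dˣ) : D) ∈ E := hp _
    have hE'' : ∀ e ∈ E, ((h⁻¹ : Dˣ) : D) * e * ((h⁻¹⁻¹ : Dˣ) : D) ∈ E := by simpa using hE'
    have h3 := conj_pow_mem (h := h⁻¹) hE'' q.natDegree (E.mul_mem (hinv _ h1) h2)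
    have e : c * ((h⁻¹ ^ d : Dˣ) : D) = ((h⁻¹ ^ q.natDegree : Dˣ) : D) *
        ((q.leadingCoeff * ((h⁻¹ ^ q.natDegree : Dˣ) : D))⁻¹ *
        (p.leadingCoeff * ((h⁻¹ ^ p.natDegree : Dˣ) : D))) * ((h⁻¹⁻¹ ^ q.natDegree : Dˣ) : D) := by
      have e1 : ((h⁻¹ ^ p.natDegree : Dˣ) : D) * ((h⁻¹⁻¹ ^ q.natDegree : Dˣ) : D)
          = ((h⁻¹ ^ d : Dˣ) : D) := by
        rw [← Units.val_mul]; congr 1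
        rw [inv_inv, hd, pow_sub _ hpq]; simp
      rw [mul_inv_rev, ← e1, hc]
      have e2 : ((h⁻¹ ^ q.natDegree : Dˣ) : D) * (((h⁻¹ ^ q.natDegree : Dˣ) : D))⁻¹ = 1 :=
        mul_inv_cancel₀ (Units.ne_zero _)
      simp only [← mul_assoc]
      rw [e2, one_mul]
    rw [e]; exact h3
  have hlq : q.leadingCoeff ≠ 0 := leadingCoeff_ne_zero.mpr hq0
  have hlp : p.leadingCoeff ≠ 0 := leadingCoeff_ne_zero.mpr hp0
  have hc0 : c ≠ 0 := mul_ne_zero (inv_ne_zero hlq) hlp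
  have hm0 : C c * X ^ d ≠ 0 := by
    rw [Ne, C_mul_X_pow_eq_monomial, monomial_eq_zero_iff]; exact hc0
  by_cases hp' : p - q * (C c * X ^ d) = 0
  · exact ⟨_, hcE, 1, Subring.one_mem _, hm0, one_ne_zero, by rw [mul_one]; exact sub_eq_zero.mp hp'⟩
  · have hdeg : (p - q * (C c * X ^ d)).degree < p.degree := by
      have hlc : (q * (C c * X ^ d)).leadingCoeff = p.leadingCoeff := by
        rw [leadingCoeff_mul, leadingCoeff_C_mul_X_pow, hc, mul_inv_cancel_left₀ hlq]
      apply degree_sub_lt_left _ hp0 hlc.symm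
      rw [degree_mul, degree_C_mul_X_pow _ hc0, degree_eq_natDegree hp0, degree_eq_natDegree hq0]
      norm_cast; omega
    have hnd := natDegree_lt_natDegree hp' hdeg
    obtain ⟨A, hA, B, hB, hA0, hB0, e⟩ := ih _ (by omega)
      (Subring.sub_mem _ hp (Subring.mul_mem _ hq hcE)) hq hp' hq0 le_rfl
    have e' : p * B = q * (A + C c * X ^ d * B) := by
      rw [mul_add, ← e, sub_mul, mul_assoc q]; simp
    refine ⟨A + C c * X ^ d * B, Subring.add_mem _ hA (Subring.mul_mem _ hcE hB), B, hB, ?_, hB0, e'⟩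
    intro h0
    rw [h0, mul_zero] at e'
    exact mul_ne_zero hp0 hB0 e'

theorem twistedPolynomials_ore_normalized (hinv : ∀ e ∈ E, e⁻¹ ∈ E)
    (hE' : ∀ e ∈ E, ((h⁻¹ : Dˣ) : D) * e * h ∈ E)
    {p q : D[X]} (hp : p ∈ twistedPolynomials E h hE) (hq : q ∈ twistedPolynomials E h hE)
    (hp0 : p.coeff 0 = 1) (hq0 : q.coeff 0 = 1) :
    ∃ A ∈ twistedPolynomials E h hE, ∃ B ∈ twistedPolynomials E h hE,
      A.coeff 0 = 1 ∧ B.coeff 0 = 1 ∧ p * A = q * B := by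
  have hp1 : p ≠ 0 := by rintro rfl; simp at hp0
  have hq1 : q ≠ 0 := by rintro rfl; simp at hq0
  obtain ⟨B, hB, A, hA, -, hA0, e⟩ := twistedPolynomials_ore hinv hE' hp hq hp1 hq1
  obtain ⟨N, hN⟩ : ∃ N, A.natDegree ≤ N := ⟨_, le_rfl⟩
  induction N generalizing A B with
  | zero =>
    have hc : A.coeff 0 = B.coeff 0 := by
      have := congrArg (fun r => coeff r 0) e
      simpa [mul_coeff_zero, hp0, hq0] using this
    have hA1 : A.coeff 0 ≠ 0 := by
      intro h0
      apply hA0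
      rw [eq_C_of_natDegree_le_zero hN, h0, C_0]
    have hcE : A.coeff 0 ∈ E := by simpa using hA 0
    have hC := C_mem_twistedPolynomials (hE := hE) (hinv _ hcE)
    refine ⟨A * C (A.coeff 0)⁻¹, Subring.mul_mem _ hA hC, B * C (A.coeff 0)⁻¹,
      Subring.mul_mem _ hB hC, ?_, ?_, ?_⟩
    · simp [mul_coeff_zero, hA1]
    · simp [mul_coeff_zero, ← hc, hA1]
    · rw [← mul_assoc, e, mul_assoc]
  | succ N ih =>
    have hc : A.coeff 0 = B.coeff 0 := by
      have := congrArg (fun r => coeff r 0) e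
      simpa [mul_coeff_zero, hp0, hq0] using this
    by_cases hA1 : A.coeff 0 = 0
    · have hshift : ∀ {A : D[X]}, A ∈ twistedPolynomials E h hE →
          A.divX * C ((h⁻¹ : Dˣ) : D) ∈ twistedPolynomials E h hE := by
        intro A hA i
        have := hA (i + 1)
        rw [coeff_mul_C, coeff_divX, mul_assoc, ← Units.val_mul, ← pow_succ']
        exact this
      have eA : A = A.divX * X := by
        conv_lhs => rw [← divX_mul_X_add A, hA1, C_0, add_zero]
      have eB : B = B.divX * X := by
        conv_lhs => rw [← divX_mul_X_add B, ← hc, hA1, C_0, add_zero]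
      have hdA : A.divX ≠ 0 := by
        intro h0; apply hA0; rw [eA, h0, zero_mul]
      refine ih _ (hshift hB) _ (hshift hA) ?_ ?_ ?_
      · exact mul_ne_zero hdA (by simp)
      · have e' : p * A.divX = q * B.divX := by
          apply mul_right_cancel₀ (b := (X : D[X])) X_ne_zero
          rw [mul_assoc, mul_assoc, ← eA, ← eB, e]
        rw [← mul_assoc, e', mul_assoc]
      · rw [natDegree_mul_C (by simp), natDegree_divX_eq_natDegree_tsub_one]; omega
    · have hcE : A.coeff 0 ∈ E := by simpa using hA 0
      have hC := C_mem_twistedPolynomials (hE := hE) (hinv _ hcE)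
      refine ⟨A * C (A.coeff 0)⁻¹, Subring.mul_mem _ hA hC, B * C (A.coeff 0)⁻¹,
        Subring.mul_mem _ hB hC, ?_, ?_, ?_⟩
      · simp [mul_coeff_zero, hA1]
      · simp [mul_coeff_zero, ← hc, hA1]
      · rw [← mul_assoc, e, mul_assoc]

theorem eval_mul_of_commute_coeff {p q : D[X]} {t : D} (hq : ∀ k, Commute (q.coeff k) t) :
    (p * q).eval t = p.eval t * q.eval t :=
  eval₂_mul_noncomm (RingHom.id D) t hq

theorem commute_coeff_of_mem_twistedPolynomials {p : D[X]} {t : D}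
    (hp : p ∈ twistedPolynomials E h hE) (ht : ∀ e ∈ E, e * t = t * e)
    (hth : (h : D) * t = t * h) (k : ℕ) : Commute (p.coeff k) t := by
  have h1 : Commute (p.coeff k * ((h⁻¹ ^ k : Dˣ) : D)) t := ht _ (hp k)
  have h2 : Commute ((h ^ k : Dˣ) : D) t := by
    rw [Units.val_pow_eq_pow_val]; exact Commute.pow_left hth k
  have := h1.mul_left h2
  rwa [mul_assoc, ← Units.val_mul, inv_pow, inv_mul_cancel, Units.val_one, mul_one] at this

theorem eval_mul_of_mem_twistedPolynomials {p q : D[X]} {t : D}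
    (hq : q ∈ twistedPolynomials E h hE) (ht : ∀ e ∈ E, e * t = t * e)
    (hth : (h : D) * t = t * h) : (p * q).eval t = p.eval t * q.eval t :=
  eval_mul_of_commute_coeff (commute_coeff_of_mem_twistedPolynomials hq ht hth)

theorem exists_iterCommutator_mul_eval_eq (hinv : ∀ e ∈ E, e⁻¹ ∈ E)
    (hE' : ∀ e ∈ E, ((h⁻¹ : Dˣ) : D) * e * h ∈ E) (ms : List Dˣ) (hms : ∀ m ∈ ms, (m : D) ∈ E)
    {y : D} (hy : y * (h⁻¹ : Dˣ) ∈ E) :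
    ∃ p ∈ twistedPolynomials E h hE, ∃ q ∈ twistedPolynomials E h hE,
      p.coeff 0 = 1 ∧ q.coeff 0 = 1 ∧ p.coeff 1 - q.coeff 1 = iterDiff ms y ∧
      ∀ t : D, (∀ e ∈ E, e * t = t * e) → (h : D) * t = t * h →
        ∀ u : Dˣ, (u : D) = 1 + y * t →
          (iterCommutator ms u : Dˣ) * q.eval t = p.eval t := by
  induction ms with
  | nil =>
    refine ⟨1 + C y * X ^ 1, Subring.add_mem _ (Subring.one_mem _)
      (C_mul_X_pow_mem_twistedPolynomials (by simpa using hy)), 1, Subring.one_mem _, ?_, ?_, ?_, ?_⟩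
    · simp
    · simp
    · simp [iterDiff, coeff_one]
    · intro t _ _ u hu
      simp [iterCommutator, hu]
  | cons m ms ih =>
    obtain ⟨p, hp, q, hq, hp0, hq0, h1, heval⟩ := ih fun a ha => hms a (by simp [ha])
    have hmE : (m : D) ∈ E := hms m (by simp)
    have hmE' : ((m⁻¹ : Dˣ) : D) ∈ E := by rw [Units.val_inv_eq_inv_val]; exact hinv _ hmE
    have hCm := C_mem_twistedPolynomials (hE := hE) hmE
    have hCm' := C_mem_twistedPolynomials (hE := hE) hmE'
    have hconj : ∀ {q : D[X]}, q ∈ twistedPolynomials E h hE →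
        C (m : D) * q * C ((m⁻¹ : Dˣ) : D) ∈ twistedPolynomials E h hE := fun hq =>
      Subring.mul_mem _ (Subring.mul_mem _ hCm hq) hCm'
    obtain ⟨a, ha, b, hb, ha0, hb0, e⟩ := twistedPolynomials_ore_normalized hinv hE' hq (hconj hq)
      hq0 (by simp [hq0])
    refine ⟨p * a, Subring.mul_mem _ hp ha, C (m : D) * p * C ((m⁻¹ : Dˣ) : D) * b,
      Subring.mul_mem _ (hconj hp) hb, by simp [mul_coeff_zero, hp0, ha0],
      by simp [mul_coeff_zero, hp0, hb0], ?_, ?_⟩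
    · have e1 := congrArg (fun r => coeff r 1) e
      have hm1 : ∀ r s : D[X], (r * s).coeff 1 = r.coeff 0 * s.coeff 1 + r.coeff 1 * s.coeff 0 := by
        intro r s
        rw [coeff_mul, Finset.Nat.antidiagonal_succ]
        simp
      simp only [hm1, ha0, hb0, hq0, hp0, mul_coeff_zero, coeff_C_zero, coeff_C_succ, mul_one,
        one_mul, mul_zero, add_zero, zero_add, Units.mul_inv] at e1 ⊢
      rw [iterDiff, ← h1, mul_sub, sub_mul]
      have e2 := eq_sub_of_add_eq e1
      rw [e2]
      abel
    · intro t ht hth u hu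
      have hw := heval t ht hth u hu
      set w : Dˣ := iterCommutator ms u with hwdef
      have ev := congrArg (eval t) e
      rw [eval_mul_of_mem_twistedPolynomials ha ht hth,
        eval_mul_of_mem_twistedPolynomials hb ht hth,
        eval_mul_of_mem_twistedPolynomials hCm' ht hth,
        eval_mul_of_mem_twistedPolynomials hq ht hth, eval_C, eval_C] at ev
      rw [eval_mul_of_mem_twistedPolynomials ha ht hth,
        eval_mul_of_mem_twistedPolynomials hb ht hth,
        eval_mul_of_mem_twistedPolynomials hCm' ht hth,
        eval_mul_of_mem_twistedPolynomials hp ht hth, eval_C, eval_C, ← hw, mul_assoc (w : D), ev]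
      rw [iterCommutator, ← hwdef]
      simp only [Units.val_mul, mul_assoc, Units.inv_mul_cancel_left]

end twisted

section twisted
open Polynomial

variable {D : Type*} [DivisionRing D] {E : Subring D} {h : Dˣ}
  {hE : ∀ e ∈ E, (h : D) * e * (h⁻¹ : Dˣ) ∈ E}

theorem exists_eq_mul_X_sub_C_add_C {R : Type*} [Ring R] (A : Subring R) {t₀ : R} (ht₀ : t₀ ∈ A)
    (N : ℕ) (p : R[X]) (hp : ∀ k, p.coeff k ∈ A) (hN : p.natDegree ≤ N) :
    ∃ g : R[X], (∀ k, g.coeff k ∈ A) ∧ g.natDegree ≤ N - 1 ∧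
      ∃ c, p = g * (X - C t₀) + C c := by
  induction N generalizing p with
  | zero => exact ⟨0, by simp [A.zero_mem], by simp, p.coeff 0, by
      rw [eq_C_of_natDegree_le_zero hN]; simp⟩
  | succ N ih =>
    obtain ⟨g, hg, hgN, c, e⟩ := ih p.divX (fun k => by rw [coeff_divX]; exact hp _)
      (by rw [natDegree_divX_eq_natDegree_tsub_one]; omega)
    have hc : c ∈ A := by
      have e0 := congrArg (fun r => coeff r 0) e
      simp only [mul_coeff_zero, coeff_add, coeff_sub, coeff_X_zero, coeff_C_zero, coeff_divX,
        zero_sub] at e0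
      rw [← sub_eq_iff_eq_add'.mpr e0]
      exact A.sub_mem (hp _) (A.mul_mem (hg 0) (A.neg_mem ht₀))
    refine ⟨g * X + C c, ?_, ?_, c * t₀ + p.coeff 0, ?_⟩
    · intro k
      rcases k with _ | k
      · simpa using hc
      · simpa [coeff_C_succ] using hg k
    · refine (natDegree_add_le _ _).trans (max_le ?_ (by simp))
      rcases N with _ | N
      · have hp0 : g = C (g.coeff 0) := eq_C_of_natDegree_le_zero (by simpa using hgN)
        have hpc : p.divX.natDegree = 0 := by
          rw [natDegree_divX_eq_natDegree_tsub_one]; omega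
        by_cases hg0 : g = 0
        · simp [hg0]
        · exfalso
          have : Nontrivial R := by
            rcases subsingleton_or_nontrivial R with hR | hR
            · exact absurd (Subsingleton.elim _ _) hg0
            · exact hR
          have e1 := congrArg (fun r => coeff r 1) e
          rw [hp0] at e1
          simp only [coeff_add, coeff_C_succ, coeff_C_mul, coeff_sub, coeff_X_one] at e1
          rw [coeff_eq_zero_of_natDegree_lt (by omega)] at e1
          apply hg0
          rw [hp0]
          simpa using e1.symm
      · refine natDegree_mul_le.trans ?_
        have := natDegree_X_le (R := R)
        omega
    · conv_lhs => rw [← divX_mul_X_add p, e]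
      have hx : (X - C t₀) * X = X * (X - C t₀) := X_mul.symm
      rw [add_mul, mul_assoc, hx, add_mul (g * X), mul_assoc g, mul_sub (C c), C_add, C_mul]
      abel

/-- A polynomial over a division ring which vanishes on an infinite commuting set that commutes
with its coefficients is zero. -/
theorem eq_zero_of_infinite_commuting_roots {S : Set D} (hS : S.Infinite)
    (hcomm : ∀ s ∈ S, ∀ t ∈ S, s * t = t * s) (p : D[X])
    (hp : ∀ k, p.coeff k ∈ Subring.centralizer S) (hroot : ∀ t ∈ S, p.eval t = 0) : p = 0 := by
  obtain ⟨N, hN⟩ : ∃ N, p.natDegree ≤ N := ⟨_, le_rfl⟩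
  have key : ∀ (N : ℕ) (S' : Set D), S' ⊆ S → S'.Infinite → ∀ p : D[X],
      (∀ k, p.coeff k ∈ Subring.centralizer S) → (∀ t ∈ S', p.eval t = 0) → p.natDegree ≤ N →
      p = 0 := by
    intro N
    induction N with
    | zero =>
      intro S' _ hinf p _ hroot hN
      obtain ⟨t, ht⟩ := hinf.nonempty
      have := hroot t ht
      rw [eq_C_of_natDegree_le_zero hN, eval_C] at this
      rw [eq_C_of_natDegree_le_zero hN, this, C_0]
    | succ N ih =>
      intro S' hS' hinf p hp hroot hN
      obtain ⟨t₀, ht₀⟩ := hinf.nonempty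
      have hA : t₀ ∈ Subring.centralizer S := by
        rw [Subring.mem_centralizer_iff]
        exact fun s hs => hcomm s hs t₀ (hS' ht₀)
      obtain ⟨g, hg, hgN, c, e⟩ := exists_eq_mul_X_sub_C_add_C _ hA (N + 1) p hp hN
      have hev : ∀ t ∈ S, p.eval t = g.eval t * (t - t₀) + c := by
        intro t ht
        rw [e, eval_add, eval_C, eval_mul_of_commute_coeff, eval_sub, eval_X, eval_C]
        intro k
        rw [coeff_sub]
        refine Commute.sub_left ?_ ?_
        · rw [coeff_X]; split_ifs <;> simp
        · rw [coeff_C]; split_ifs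
          · exact hcomm _ (hS' ht₀) _ ht
          · simp
      have hc : c = 0 := by
        have := hev t₀ (hS' ht₀)
        rw [hroot t₀ ht₀] at this
        simpa using this.symm
      have hg0 : g = 0 := by
        refine ih (S' \ {t₀}) (Set.sdiff_subset.trans hS') (hinf.sdiff (Set.finite_singleton _)) g hg
          ?_ (by simpa using hgN)
        intro t ht
        have := hev t (hS' ht.1)
        rw [hroot t ht.1, hc, add_zero] at this
        exact (mul_eq_zero.mp this.symm).resolve_right (sub_ne_zero.mpr ht.2)
      rw [e, hg0, hc]; simp
  exact key N S subset_rfl hS p hp hroot hN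

theorem exists_minimal_twisted_relation (hinv : ∀ e ∈ E, e⁻¹ ∈ E)
    (hE' : ∀ e ∈ E, ((h⁻¹ : Dˣ) : D) * e * h ∈ E)
    (hex : ∃ p ∈ twistedPolynomials E h hE, p ≠ 0 ∧ p.eval 1 = 0) :
    ∃ p ∈ twistedPolynomials E h hE, p.eval 1 = 0 ∧ 0 < p.natDegree ∧
      p.leadingCoeff = ((h ^ p.natDegree : Dˣ) : D) ∧ p.coeff 0 ≠ 0 ∧
      ∀ e ∈ E, ∀ i, e * p.coeff i = p.coeff i *
        (((h⁻¹ ^ p.natDegree : Dˣ) : D) * e * ((h ^ p.natDegree : Dˣ) : D)) := by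
  classical
  have hex' : ∃ n, ∃ p ∈ twistedPolynomials E h hE, p ≠ 0 ∧ p.eval 1 = 0 ∧ p.natDegree = n := by
    obtain ⟨p, hp, h0, h1⟩ := hex
    exact ⟨_, p, hp, h0, h1, rfl⟩
  obtain ⟨p₁, hp₁, h₁0, h₁1, h₁n⟩ := Nat.find_spec hex'
  have hmin : ∀ q ∈ twistedPolynomials E h hE, q.eval 1 = 0 → q.natDegree < p₁.natDegree →
      q = 0 := by
    intro q hq hq1 hlt
    by_contra hq0
    exact Nat.find_min hex' (h₁n ▸ hlt) ⟨q, hq, hq0, hq1, rfl⟩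
  clear h₁n
  set n := p₁.natDegree with hn
  have hn0 : 0 < n := by
    by_contra hcon
    have hC := eq_C_of_natDegree_le_zero (p := p₁) (by omega)
    rw [hC, eval_C] at h₁1
    rw [h₁1, C_0] at hC
    exact h₁0 hC
  set e₁ := p₁.leadingCoeff * ((h⁻¹ ^ n : Dˣ) : D) with he₁
  have he₁E : e₁ ∈ E := hp₁ n
  have he₁0 : e₁ ≠ 0 := mul_ne_zero (leadingCoeff_ne_zero.mpr h₁0) (Units.ne_zero _)
  have hevC : ∀ (q : D[X]) (c : D), (q * C c).eval 1 = q.eval 1 * c := by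
    intro q c
    rw [eval_mul_of_commute_coeff (fun k => Commute.one_right _), eval_C]
  set p := C e₁⁻¹ * p₁ with hpdef
  have hp : p ∈ twistedPolynomials E h hE :=
    Subring.mul_mem _ (C_mem_twistedPolynomials (hinv _ he₁E)) hp₁
  have hpn : p.natDegree = n := natDegree_C_mul (inv_ne_zero he₁0)
  have hp0 : p ≠ 0 := mul_ne_zero (by simpa using he₁0) h₁0
  have hlead : p.leadingCoeff = ((h ^ n : Dˣ) : D) := by
    rw [hpdef, leadingCoeff_mul, leadingCoeff_C, he₁, mul_inv_rev, mul_assoc,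
      inv_mul_cancel₀ (leadingCoeff_ne_zero.mpr h₁0), mul_one, ← Units.val_inv_eq_inv_val]
    simp
  have hev : p.eval 1 = 0 := by rw [hpdef, eval_C_mul, h₁1, mul_zero]
  refine ⟨p, hp, hev, hpn ▸ hn0, hpn ▸ hlead, ?_, ?_⟩
  · intro h0
    have eA : p = p.divX * X := by
      conv_lhs => rw [← divX_mul_X_add p, h0, C_0, add_zero]
    have hq : p.divX * C ((h⁻¹ : Dˣ) : D) = 0 := by
      apply hmin
      · intro i
        have := hp (i + 1)
        rw [coeff_mul_C, coeff_divX, mul_assoc, ← Units.val_mul, ← pow_succ']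
        exact this
      · rw [hevC]
        have : p.eval 1 = p.divX.eval 1 := by
          conv_lhs => rw [eA]
          simp
        rw [← this, hev, zero_mul]
      · rw [natDegree_mul_C (by simp), natDegree_divX_eq_natDegree_tsub_one]; omega
    rw [mul_eq_zero] at hq
    rcases hq with hq | hq
    · rw [hq, zero_mul] at eA; exact hp0 eA
    · simp at hq
  · intro e he i
    rw [hpn]
    set e' := ((h⁻¹ ^ n : Dˣ) : D) * e * ((h ^ n : Dˣ) : D) with he'
    have he'E : e' ∈ E := by
      have hE'' : ∀ e ∈ E, ((h⁻¹ : Dˣ) : D) * e * ((h⁻¹⁻¹ : Dˣ) : D) ∈ E := by simpa using hE'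
      have := conj_pow_mem (h := h⁻¹) hE'' n he
      rwa [inv_inv] at this
    by_cases he0 : e = 0
    · simp [he', he0]
    have he'0 : e' ≠ 0 := mul_ne_zero (mul_ne_zero (Units.ne_zero _) he0) (Units.ne_zero _)
    have hz : C e * p - p * C e' = 0 := by
      by_contra hne
      apply hne
      apply hmin
      · exact Subring.sub_mem _ (Subring.mul_mem _ (C_mem_twistedPolynomials he) hp)
          (Subring.mul_mem _ hp (C_mem_twistedPolynomials he'E))
      · rw [eval_sub, hevC, eval_C_mul, hev]; simp
      · rw [← hpn, ← natDegree_C_mul (p := p) he0]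
        apply natDegree_lt_natDegree hne
        apply degree_sub_lt_left
        · rw [degree_C_mul he0, degree_mul_C he'0]
        · exact mul_ne_zero (by simpa using he0) hp0
        · rw [leadingCoeff_mul _ p, leadingCoeff_mul p, leadingCoeff_C, leadingCoeff_C, hlead, he',
            mul_assoc, ← mul_assoc ((h ^ n : Dˣ) : D), ← Units.val_mul]
          simp
    have := congrArg (fun r => coeff r i) (sub_eq_zero.mp hz)
    simpa using this

theorem finite_closure_of_twisted_relation (hfin : Finite E) {p : D[X]}
    (hp : p ∈ twistedPolynomials E h hE) (hev : p.eval 1 = 0) (hdeg : 0 < p.natDegree)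
    (hlead : p.leadingCoeff = ((h ^ p.natDegree : Dˣ) : D)) :
    Finite (Subring.closure ((E : Set D) ∪ {(h : D)})) := by
  set n := p.natDegree with hn
  have hevmul : ∀ q r : D[X], (q * r).eval 1 = q.eval 1 * r.eval 1 := fun q r =>
    eval_mul_of_commute_coeff (fun k => Commute.one_right _)
  set F : Set D := {x | ∃ r ∈ twistedPolynomials E h hE, r.degree < n ∧ r.eval 1 = x} with hF
  have hFfin : F.Finite := by
    refine (Set.finite_range fun f : Fin n → E => ∑ i, (f i : D) * ((h ^ (i : ℕ) : Dˣ) : D)).subset ?_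
    rintro x ⟨r, hr, hrn, rfl⟩
    refine ⟨fun i => ⟨_, hr i⟩, ?_⟩
    have hlt : r.natDegree < n := by
      by_cases h0 : r = 0
      · simpa [h0] using hdeg
      · exact (natDegree_lt_iff_degree_lt h0).mpr hrn
    rw [eval_eq_sum_range' hlt, ← Fin.sum_univ_eq_sum_range (fun i => r.coeff i * 1 ^ i)]
    refine Finset.sum_congr rfl fun i _ => ?_
    rw [mul_assoc, ← Units.val_mul]
    simp
  have hone : (1 : D) ∈ F := ⟨1, Subring.one_mem _, by rw [degree_one]; exact_mod_cast hdeg, by simp⟩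
  have hadd : ∀ x ∈ F, ∀ y ∈ F, x + y ∈ F := by
    rintro x ⟨r, hr, hrn, rfl⟩ y ⟨s, hs, hsn, rfl⟩
    exact ⟨r + s, Subring.add_mem _ hr hs, (degree_add_le _ _).trans_lt (max_lt hrn hsn), by simp⟩
  have hneg : ∀ x ∈ F, -x ∈ F := by
    rintro x ⟨r, hr, hrn, rfl⟩
    exact ⟨-r, Subring.neg_mem _ hr, by rwa [degree_neg], by simp⟩
  have hzero : (0 : D) ∈ F := ⟨0, Subring.zero_mem _, by rw [degree_zero]; exact WithBot.bot_lt_coe _, by simp⟩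
  have hmulE : ∀ e ∈ E, ∀ x ∈ F, x * e ∈ F := by
    rintro e he x ⟨r, hr, hrn, rfl⟩
    refine ⟨r * C e, Subring.mul_mem _ hr (C_mem_twistedPolynomials he), ?_, by
      rw [hevmul, eval_C]⟩
    rw [degree_mul]
    calc r.degree + (C e).degree ≤ r.degree + 0 := by gcongr; exact degree_C_le
      _ < n := by simpa using hrn
  have hmulh : ∀ x ∈ F, x * h ∈ F := by
    rintro x ⟨r, hr, hrn, rfl⟩
    have hX : C (h : D) * X ^ 1 ∈ twistedPolynomials E h hE :=
      C_mul_X_pow_mem_twistedPolynomials (by simp [E.one_mem])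
    set s := r * (C (h : D) * X ^ 1) with hs
    have hsR : s ∈ twistedPolynomials E h hE := Subring.mul_mem _ hr hX
    have hsev : s.eval 1 = r.eval 1 * h := by rw [hs, hevmul]; simp
    have hsdeg : s.degree ≤ n := by
      by_cases h0 : r = 0
      · simp [hs, h0]
      · rw [hs, degree_mul, degree_C_mul_X_pow _ (Units.ne_zero h), degree_eq_natDegree h0]
        rw [degree_eq_natDegree h0] at hrn
        norm_cast at hrn ⊢
    have hc : s.coeff n * ((h⁻¹ ^ n : Dˣ) : D) ∈ E := hsR n
    set c := s.coeff n * ((h⁻¹ ^ n : Dˣ) : D) with hcdef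
    refine ⟨s - C c * p, Subring.sub_mem _ hsR (Subring.mul_mem _ (C_mem_twistedPolynomials hc) hp),
      ?_, ?_⟩
    · rw [degree_lt_iff_coeff_zero]
      intro m hm
      rcases hm.eq_or_lt with rfl | hm
      · rw [coeff_sub, coeff_C_mul]
        have : p.coeff n = ((h ^ n : Dˣ) : D) := hlead
        rw [this, hcdef, mul_assoc, ← Units.val_mul]
        simp
      · rw [coeff_sub, coeff_C_mul, coeff_eq_zero_of_natDegree_lt (p := p) hm,
          coeff_eq_zero_of_degree_lt (hsdeg.trans_lt (by exact_mod_cast hm))]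
        simp
    · rw [eval_sub, hevmul (C c), hev, hsev]; simp
  have key : ∀ x ∈ Subring.closure ((E : Set D) ∪ {(h : D)}), ∀ f ∈ F, f * x ∈ F := by
    intro x hx
    induction hx using Subring.closure_induction with
    | mem x hx =>
      rcases hx with hx | hx
      · exact hmulE x hx
      · rw [Set.mem_singleton_iff] at hx; subst hx; exact hmulh
    | zero => intro f _; simpa using hzero
    | one => intro f hf; simpa using hf
    | add x y _ _ hx hy => intro f hf; rw [mul_add]; exact hadd _ (hx f hf) _ (hy f hf)
    | neg x _ hx => intro f hf; rw [mul_neg]; exact hneg _ (hx f hf)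
    | mul x y _ _ hx hy => intro f hf; rw [← mul_assoc]; exact hy _ (hx f hf)
  exact (hFfin.subset fun x hx => by simpa using key x hx 1 hone).to_subtype

theorem mul_comm_of_finite_subring (T : Subring D) (hT : Finite T) {x y : D} (hx : x ∈ T)
    (hy : y ∈ T) : x * y = y * x := by
  have := (Finite.isDomain_to_isField T).mul_comm ⟨x, hx⟩ ⟨y, hy⟩
  exact congrArg Subtype.val this

end twisted

theorem finite_of_finite_fixedPoints {K : Type*} [Field K] (φ : K ≃+* K) {n : ℕ} (hn : 0 < n)
    (hφ : φ ^ n = 1) (hf : {x | φ x = x}.Finite) : Finite K := by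
  have hfo : IsOfFinOrder φ := isOfFinOrder_iff_pow_eq_one.mpr ⟨n, hn, hφ⟩
  have : Finite (Subgroup.zpowers φ) := by
    rw [← Nat.card_pos_iff.trans (and_iff_right inferInstance), Nat.card_zpowers]
    exact hfo.orderOf_pos
  have hfix : Finite (FixedPoints.subfield (Subgroup.zpowers φ) K) := by
    refine (hf.subset ?_).to_subtype
    intro x hx
    exact hx ⟨φ, Subgroup.mem_zpowers φ⟩
  exact Module.finite_of_finite (FixedPoints.subfield (Subgroup.zpowers φ) K)

theorem exists_eigenvector_of_not_commute {D K : Type*} [DivisionRing D] [Field K] [Finite K]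
    (f : K →+* D) (a : Kˣ) (b : D) (hab : f a * b ≠ b * f a) (L : Subring D)
    (hfL : ∀ x, f x ∈ L) (hb : b ∈ L) :
    ∃ e : Kˣ, e ≠ a ∧ ∃ y ∈ L, y ≠ 0 ∧ y * f a = f e * y := by
  classical
  have := Fintype.ofFinite K
  set N := Fintype.card K - 1 with hN
  have hN0 : 0 < N := by
    have := Fintype.one_lt_card (α := K)
    omega
  have hpow : ∀ e : Kˣ, e ^ N = 1 := fun e => by
    ext; exact FiniteField.pow_card_sub_one_eq_one _ e.ne_zero
  set y : Kˣ → D := fun e => ∑ i ∈ Finset.range N, f ((e ^ i : Kˣ) : K) * b * f ((a⁻¹ ^ i : Kˣ) : K)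
    with hy
  have hyL : ∀ e, y e ∈ L := fun e =>
    L.sum_mem fun i _ => L.mul_mem (L.mul_mem (hfL _) hb) (hfL _)
  have hya : ∀ e, y e * f a = f e * y e := by
    intro e
    have h1 : f e * y e * f ((a⁻¹ : Kˣ) : K) = y e := by
      have e1 : f e * y e * f ((a⁻¹ : Kˣ) : K) = ∑ i ∈ Finset.range N,
          f ((e ^ (i + 1) : Kˣ) : K) * b * f ((a⁻¹ ^ (i + 1) : Kˣ) : K) := by
        rw [hy, Finset.mul_sum, Finset.sum_mul]
        refine Finset.sum_congr rfl fun i _ => ?_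
        rw [pow_succ' e, pow_succ a⁻¹, Units.val_mul, Units.val_mul, map_mul, map_mul]
        simp only [mul_assoc]
      have e2 := Finset.sum_range_succ
        (fun i => f ((e ^ i : Kˣ) : K) * b * f ((a⁻¹ ^ i : Kˣ) : K)) N
      rw [Finset.sum_range_succ'] at e2
      rw [e1]
      simpa [y, hpow, inv_pow] using e2
    conv_lhs => rw [← h1]
    rw [mul_assoc (f e * y e), ← map_mul]
    simp
  by_contra! hcon
  have hz : ∀ e, e ≠ a → y e = 0 := by
    intro e he
    by_contra h0
    exact hcon e he (y e) (hyL e) h0 (hya e)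
  have hsum : ∑ e : Kˣ, y e = -b := by
    rw [hy, Finset.sum_comm]
    have : ∀ i ∈ Finset.range N, ∑ e : Kˣ, f ((e ^ i : Kˣ) : K) * b * f ((a⁻¹ ^ i : Kˣ) : K) =
        f (if N ∣ i then -1 else 0) * b * f ((a⁻¹ ^ i : Kˣ) : K) := by
      intro i _
      rw [← Finset.sum_mul, ← Finset.sum_mul, ← map_sum]
      congr 3
      have := FiniteField.sum_pow_units (K := K) i
      simpa using this
    rw [Finset.sum_congr rfl this, Finset.sum_eq_single 0]
    · simp
    · intro i hi hi0
      rw [if_neg]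
      · simp
      · intro hd
        exact absurd (Nat.le_of_dvd (Nat.pos_of_ne_zero hi0) hd) (by simpa using hi)
    · intro h0; simp at h0; omega
  rw [Finset.sum_eq_single a (fun e _ he => hz e he) (by simp)] at hsum
  have := hya a
  rw [hsum] at this
  simp only [neg_mul, mul_neg, neg_inj] at this
  exact hab this.symm

section groups
variable {D : Type*} [DivisionRing D]

theorem Subring.inv_mem_centralizer {S : Set D} {e : D} (he : e ∈ Subring.centralizer S) :
    e⁻¹ ∈ Subring.centralizer S := by
  rw [Subring.mem_centralizer_iff] at he ⊢
  exact fun s hs => (Commute.inv_right₀ (he s hs))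

theorem Units.conj_mem_centralizer {T : Set D} {u : Dˣ}
    (hu : ∀ t ∈ T, (u : D) * t * (u⁻¹ : Dˣ) ∈ Subring.centralizer (Subring.centralizer T : Set D))
    {c : D} (hc : c ∈ Subring.centralizer T) :
    ((u⁻¹ : Dˣ) : D) * c * u ∈ Subring.centralizer T := by
  rw [Subring.mem_centralizer_iff]
  intro t ht
  have h1 : c * ((u : D) * t * (u⁻¹ : Dˣ)) = (u : D) * t * (u⁻¹ : Dˣ) * c :=
    (Subring.mem_centralizer_iff.mp (hu t ht)) c hc
  have h2 := congrArg (fun z => ((u⁻¹ : Dˣ) : D) * z * u) h1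
  simpa [mul_assoc] using h2.symm

theorem subset_centralizer_centralizer (T : Set D) {t : D} (ht : t ∈ T) :
    t ∈ Subring.centralizer (Subring.centralizer T : Set D) := by
  rw [Subring.mem_centralizer_iff]
  exact fun c hc => ((Subring.mem_centralizer_iff.mp hc) t ht).symm

theorem finite_of_conj_pow_eq {E : Subring D} (hcomm : ∀ a ∈ E, ∀ b ∈ E, a * b = b * a)
    (hinv : ∀ e ∈ E, e⁻¹ ∈ E) {h : Dˣ} (hE : ∀ e ∈ E, (h : D) * e * (h⁻¹ : Dˣ) ∈ E)
    (hE' : ∀ e ∈ E, ((h⁻¹ : Dˣ) : D) * e * h ∈ E) {n : ℕ} (hn : 0 < n)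
    (hpow : ∀ e ∈ E, ((h ^ n : Dˣ) : D) * e = e * ((h ^ n : Dˣ) : D))
    (hfin : {e : D | e ∈ E ∧ (h : D) * e = e * h}.Finite) : Finite E := by
  have hF : IsField E :=
    ⟨exists_pair_ne E, fun a b => Subtype.ext (hcomm a a.2 b b.2), fun {a} ha =>
      ⟨⟨a⁻¹, hinv a a.2⟩, Subtype.ext (mul_inv_cancel₀ fun h0 => ha (Subtype.ext h0))⟩⟩
  let φ : E ≃+* E :=
    { toFun := fun e => ⟨_, hE e e.2⟩
      invFun := fun e => ⟨_, hE' e e.2⟩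
      left_inv := fun e => Subtype.ext (by simp [mul_assoc])
      right_inv := fun e => Subtype.ext (by simp [mul_assoc])
      map_mul' := fun a b => Subtype.ext (by simp [mul_assoc])
      map_add' := fun a b => Subtype.ext (by simp [mul_add, add_mul]) }
  have hφ : ∀ (k : ℕ) (x : E), (((φ ^ k) x : E) : D) * ((h ^ k : Dˣ) : D) =
      ((h ^ k : Dˣ) : D) * x := by
    intro k
    induction k with
    | zero => intro x; simp
    | succ k ih =>
      intro x
      have e1 : (φ ^ (k + 1)) x = φ ((φ ^ k) x) := by rw [pow_succ']; rfl
      have e2 : ((φ ((φ ^ k) x) : E) : D) = (h : D) * ((φ ^ k) x : E) * (h⁻¹ : Dˣ) := rfl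
      rw [e1, e2, pow_succ', Units.val_mul, mul_assoc, mul_assoc, Units.inv_mul_cancel_left, ih,
        mul_assoc]
  refine @finite_of_finite_fixedPoints E hF.toField φ n hn ?_ ?_
  · refine RingEquiv.ext fun x => Subtype.ext ?_
    have := hφ n x
    rw [hpow x x.2] at this
    exact mul_right_cancel₀ (Units.ne_zero _) this
  · refine Set.Finite.of_finite_image (f := Subtype.val) (hfin.subset ?_)
      Subtype.val_injective.injOn
    rintro _ ⟨x, hx, rfl⟩
    refine ⟨x.2, ?_⟩
    have : (h : D) * x * (h⁻¹ : Dˣ) = x := congrArg Subtype.val hx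
    conv_rhs => rw [← this]
    simp [mul_assoc]

open Polynomial in
theorem exists_iterCommutator_replicate_ne_one {E : Subring D}
    (hcomm : ∀ a ∈ E, ∀ b ∈ E, a * b = b * a)
    (hinv : ∀ e ∈ E, e⁻¹ ∈ E) {h : Dˣ} (hE : ∀ e ∈ E, (h : D) * e * (h⁻¹ : Dˣ) ∈ E)
    (hE' : ∀ e ∈ E, ((h⁻¹ : Dˣ) : D) * e * h ∈ E) {g : Dˣ} (hg : (g : D) ∈ E)
    (hgh : g * h ≠ h * g) (n : ℕ) : ∃ x : Dˣ, iterCommutator (List.replicate n g) x ≠ 1 := by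
  by_contra! hcon
  have hgh' : (g : D) * h ≠ h * g := fun e => hgh (Units.ext e)
  obtain ⟨p, hp, q, hq, -, -, h1, heval⟩ := exists_iterCommutator_mul_eval_eq (hE := hE) hinv hE'
    (List.replicate n g) (fun m hm => by rw [List.eq_of_mem_replicate hm]; exact hg)
    (y := (h : D)) (by simp [E.one_mem])
  have hroot : ∀ t : D, (∀ e ∈ E, e * t = t * e) → (h : D) * t = t * h → 1 + (h : D) * t ≠ 0 →
      (p - q).eval t = 0 := by
    intro t ht hth h0
    have := heval t ht hth (Units.mk0 _ h0) rfl
    rw [hcon] at this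
    rw [eval_sub, ← this]; simp
  have hginv : ((g⁻¹ : Dˣ) : D) ∈ E := by rw [Units.val_inv_eq_inv_val]; exact hinv _ hg
  set μ : D := g * (h * ((g⁻¹ : Dˣ) : D) * (h⁻¹ : Dˣ)) with hμ
  have hμE : μ ∈ E := E.mul_mem hg (hE _ hginv)
  have hμ1 : 1 - μ ≠ 0 := by
    intro h0
    apply hgh
    have h2 : g * (h * g⁻¹ * h⁻¹) = 1 := Units.ext (sub_eq_zero.mp h0).symm
    calc g * h = (g * (h * g⁻¹ * h⁻¹)) * (h * g) := by group
      _ = h * g := by rw [h2, one_mul]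
  have hdl : ∀ n, iterDiff (List.replicate n g) (h : D) = (1 - μ) ^ n * h := by
    intro n
    induction n with
    | zero => simp [iterDiff]
    | succ n ih =>
      rw [List.replicate_succ, iterDiff, ih, pow_succ, mul_assoc _ _ (h : D), sub_mul, one_mul,
        mul_sub, ← mul_assoc (g : D), hcomm _ hg _ (E.pow_mem (E.sub_mem E.one_mem hμE) n)]
      congr 1
      simp [hμ, mul_assoc]
  have hpq : p - q ≠ 0 := by
    intro h0
    have := congrArg (fun r => coeff r 1) h0
    simp only [coeff_sub, coeff_zero] at this
    rw [h1, hdl] at this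
    exact mul_ne_zero (pow_ne_zero n hμ1) (Units.ne_zero h) this
  have hpqR := Subring.sub_mem _ hp hq
  by_cases hfin : {e : D | e ∈ E ∧ (h : D) * e = e * h}.Finite
  · have h1' : 1 + (h : D) * 1 ≠ 0 := by
      intro h0
      apply hgh'
      have : (h : D) = -1 := by
        rw [mul_one] at h0; exact eq_neg_of_add_eq_zero_right h0
      rw [this]; simp
    obtain ⟨r, hr, hr1, hrdeg, hrlead, hr0, hrel⟩ := exists_minimal_twisted_relation hinv hE'
      ⟨p - q, hpqR, hpq, hroot 1 (by simp) (by simp) h1'⟩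
    have hr0E : r.coeff 0 ∈ E := by simpa using hr 0
    have hEfin : Finite E := by
      refine finite_of_conj_pow_eq hcomm hinv hE hE' hrdeg ?_ hfin
      intro e he
      have hE'' : ∀ e ∈ E, ((h⁻¹ : Dˣ) : D) * e * ((h⁻¹⁻¹ : Dˣ) : D) ∈ E := by simpa using hE'
      have h2 := conj_pow_mem (h := h⁻¹) hE'' r.natDegree he
      have h3 := hrel e he 0
      rw [hcomm e he _ hr0E] at h3
      have h4 := mul_left_cancel₀ hr0 h3
      rw [inv_pow, mul_assoc] at h4
      conv_lhs => rw [h4]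
      rw [Units.mul_inv_cancel_left]
    have hcl := finite_closure_of_twisted_relation hEfin hr hr1 hrdeg hrlead
    exact hgh' (mul_comm_of_finite_subring _ hcl (Subring.subset_closure (Or.inl hg))
      (Subring.subset_closure (Or.inr rfl)))
  · set S := {e : D | e ∈ E ∧ (h : D) * e = e * h} \ {t | 1 + (h : D) * t = 0} with hS
    have hSinf : S.Infinite := by
      refine Set.Infinite.sdiff hfin (Set.Subsingleton.finite ?_)
      intro a ha b hb
      have : 1 + (h : D) * a = 1 + (h : D) * b := by
        rw [Set.mem_ofPred_eq.mp ha, Set.mem_ofPred_eq.mp hb]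
      exact mul_left_cancel₀ (Units.ne_zero h) (add_left_cancel this)
    refine hpq (eq_zero_of_infinite_commuting_roots hSinf
      (fun s hs t ht => hcomm s hs.1.1 t ht.1.1) _ ?_ ?_)
    · intro k
      rw [Subring.mem_centralizer_iff]
      intro t ht
      exact (commute_coeff_of_mem_twistedPolynomials hpqR (fun e he => hcomm e he t ht.1.1)
        ht.1.2 k).symm
    · intro t ht
      exact hroot t (fun e he => hcomm e he t ht.1.1) ht.1.2 ht.2

theorem exists_iterCommutator_replicate_ne_one_of_normalizes {S : Set D}
    (hS : ∀ s ∈ S, ∀ t ∈ S, s * t = t * s) {h : Dˣ}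
    (h1 : ∀ t ∈ S, (h : D) * t * (h⁻¹ : Dˣ) ∈ Subring.centralizer (Subring.centralizer S : Set D))
    (h2 : ∀ t ∈ S, ((h⁻¹ : Dˣ) : D) * t * h ∈ Subring.centralizer (Subring.centralizer S : Set D))
    {g : Dˣ} (hg : (g : D) ∈ S) (hgh : g * h ≠ h * g) (n : ℕ) :
    ∃ x : Dˣ, iterCommutator (List.replicate n g) x ≠ 1 := by
  have hSC : ∀ s ∈ S, s ∈ Subring.centralizer S := fun s hs =>
    Subring.mem_centralizer_iff.mpr fun t ht => hS t ht s hs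
  have c1 : ∀ c ∈ Subring.centralizer S, ((h⁻¹ : Dˣ) : D) * c * h ∈ Subring.centralizer S :=
    fun c hc => Units.conj_mem_centralizer h1 hc
  have c2 : ∀ c ∈ Subring.centralizer S, (h : D) * c * (h⁻¹ : Dˣ) ∈ Subring.centralizer S := by
    intro c hc
    have := Units.conj_mem_centralizer (u := h⁻¹) (by simpa using h2) hc
    simpa using this
  refine exists_iterCommutator_replicate_ne_one
    (E := Subring.centralizer (Subring.centralizer S : Set D)) ?_
    (fun e he => Subring.inv_mem_centralizer he) ?_ ?_ (subset_centralizer_centralizer S hg) hgh n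
  · intro a ha b hb
    refine (Subring.mem_centralizer_iff.mp hb) a ?_
    refine Subring.mem_centralizer_iff.mpr fun s hs => ?_
    exact (Subring.mem_centralizer_iff.mp ha) s (hSC s hs)
  · intro e he
    have := Units.conj_mem_centralizer (T := (Subring.centralizer S : Set D)) (u := h⁻¹) (fun c hc => by
      rw [inv_inv]; exact subset_centralizer_centralizer _ (c1 c hc)) he
    simpa using this
  · intro e he
    exact Units.conj_mem_centralizer (T := (Subring.centralizer S : Set D)) (u := h) (fun c hc =>
      subset_centralizer_centralizer _ (c2 c hc)) he

theorem SubnormalDepth.le_center_of_commute {r : ℕ} {G : Subgroup Dˣ} (hG : SubnormalDepth r G)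
    (hcomm : ∀ a ∈ G, ∀ b ∈ G, a * b = b * a) : G ≤ Subgroup.center Dˣ := by
  induction r generalizing G with
  | zero =>
    rw [SubnormalDepth] at hG
    subst hG
    exact fun a _ => Subgroup.mem_center_iff.mpr fun b => hcomm b trivial a trivial
  | succ r ih =>
    have hG' := hG
    obtain ⟨H, hH, hle, hconj⟩ := hG
    by_cases hGH : ∃ g ∈ G, ∃ h ∈ H, g * h ≠ h * g
    · obtain ⟨g, hg, h, hh, hgh⟩ := hGH
      exfalso
      have hconj' : ∀ x ∈ H, ∀ t ∈ (fun u : Dˣ => (u : D)) '' (G : Set Dˣ),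
          (x : D) * t * (x⁻¹ : Dˣ) ∈ (fun u : Dˣ => (u : D)) '' (G : Set Dˣ) := by
        rintro x hx _ ⟨u, hu, rfl⟩
        exact ⟨x * u * x⁻¹, hconj u hu x hx, by simp⟩
      obtain ⟨x, hx⟩ := exists_iterCommutator_replicate_ne_one_of_normalizes
        (S := (fun u : Dˣ => (u : D)) '' (G : Set Dˣ)) (h := h) (g := g)
        (by
          rintro _ ⟨a, ha, rfl⟩ _ ⟨b, hb, rfl⟩
          exact congrArg Units.val (hcomm a ha b hb))
        (fun t ht => subset_centralizer_centralizer _ (hconj' h hh t ht))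
        (fun t ht => subset_centralizer_centralizer _
          (by simpa only [inv_inv] using hconj' h⁻¹ (H.inv_mem hh) t ht))
        ⟨g, hg, rfl⟩ hgh (r + 2)
      apply hx
      have hw := hG'.iterCommutator_mem (List.replicate (r + 1) g)
        (fun m hm => by rw [List.eq_of_mem_replicate hm]; exact hg) (by simp) x
      rw [List.replicate_succ, iterCommutator, hcomm _ hw _ hg, mul_inv_cancel_right,
        mul_inv_cancel]
    · push Not at hGH
      cases r with
      | zero =>
        rw [SubnormalDepth] at hH
        subst hH
        exact fun a ha => Subgroup.mem_center_iff.mpr fun b => (hGH a ha b trivial).symm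
      | succ r =>
        obtain ⟨B, hB, hHB, hBconj⟩ := hH
        have hZ : SubnormalDepth (r + 1) (H ⊓ Subgroup.centralizer (H : Set Dˣ)) := by
          refine ⟨B, hB, inf_le_left.trans hHB, ?_⟩
          rintro x ⟨hx, hxc⟩ y hy
          refine ⟨hBconj x hx y hy, ?_⟩
          refine Subgroup.mem_centralizer_iff.mpr fun z hz => ?_
          have h1 := hBconj z hz y⁻¹ (B.inv_mem hy)
          have h2 := congrArg (fun w => y * w * y⁻¹) (Subgroup.mem_centralizer_iff.mp hxc _ h1)
          simpa [mul_assoc] using h2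
        refine le_trans ?_ (ih hZ ?_)
        · intro g hg
          exact ⟨hle hg, Subgroup.mem_centralizer_iff.mpr fun h hh => (hGH g hg h hh).symm⟩
        · rintro a ⟨ha, hac⟩ b ⟨hb, hbc⟩
          exact Subgroup.mem_centralizer_iff.mp hbc a ha

theorem SubnormalDepth.le_center_of_commutator_central {r : ℕ} {G : Subgroup Dˣ}
    (hG : SubnormalDepth r G)
    (hcomm : ∀ a ∈ G, ∀ b ∈ G, a * b * a⁻¹ * b⁻¹ ∈ Subgroup.center Dˣ) :
    G ≤ Subgroup.center Dˣ := by
  by_cases hab : ∀ a ∈ G, ∀ b ∈ G, a * b = b * a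
  · exact hG.le_center_of_commute hab
  · exfalso
    push Not at hab
    obtain ⟨g, hg, h, hh, hgh⟩ := hab
    have hmem : ∀ x ∈ G, (x : D) * g * (x⁻¹ : Dˣ) ∈
        Subring.centralizer (Subring.centralizer {(g : D)} : Set D) := by
      intro x hx
      have h1 := hcomm x hx g hg
      have e : (x : D) * g * (x⁻¹ : Dˣ) = ((x * g * x⁻¹ * g⁻¹ : Dˣ) : D) * g := by
        rw [← Units.val_mul, ← Units.val_mul, ← Units.val_mul]; simp
      rw [e]
      refine Subring.mul_mem _ ?_ (subset_centralizer_centralizer _ rfl)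
      rw [Subring.mem_centralizer_iff]
      intro c _
      by_cases hc : c = 0
      · simp [hc]
      · exact congrArg Units.val ((Subgroup.mem_center_iff.mp h1) (Units.mk0 c hc))
    obtain ⟨x, hx⟩ := exists_iterCommutator_replicate_ne_one_of_normalizes
      (S := {(g : D)}) (h := h) (g := g) (by simp) (by rintro _ rfl; exact hmem h hh)
      (by rintro _ rfl; simpa using hmem h⁻¹ (G.inv_mem hh)) rfl hgh (r + 2)
    apply hx
    have hw := hG.iterCommutator_mem (List.replicate r g)
      (fun m hm => by rw [List.eq_of_mem_replicate hm]; exact hg) (by simp) x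
    rw [List.replicate_succ, iterCommutator, List.replicate_succ, iterCommutator,
      ← (Subgroup.mem_center_iff.mp (hcomm _ hw _ hg)) g, mul_inv_cancel_right, mul_inv_cancel]

end groups

section groups
open scoped commutatorElement
variable {D : Type*} [DivisionRing D]

theorem commutatorElement_mul_comm_of_mem_center {Γ : Type*} [Group Γ] {k a b : Γ}
    (ha : k * a * k⁻¹ * a⁻¹ ∈ Subgroup.center Γ) (hb : k * b * k⁻¹ * b⁻¹ ∈ Subgroup.center Γ) :
    ⁅a, b⁆ * k = k * ⁅a, b⁆ := by
  have hca := Subgroup.mem_center_iff.mp ha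
  have hcb := Subgroup.mem_center_iff.mp hb
  set za := k * a * k⁻¹ * a⁻¹ with hza
  set zb := k * b * k⁻¹ * b⁻¹ with hzb
  have ea : k * a * k⁻¹ = za * a := by rw [hza]; group
  have eb : k * b * k⁻¹ = zb * b := by rw [hzb]; group
  have e1 : k * ⁅a, b⁆ * k⁻¹ = ⁅k * a * k⁻¹, k * b * k⁻¹⁆ := by
    simp only [commutatorElement_def]; group
  have e2 : ⁅za * a, zb * b⁆ = ⁅a, b⁆ := by
    have h1 : ∀ c, Commute za c := fun c => (hca c).symm
    have h2 : ∀ c, Commute zb c := fun c => (hcb c).symm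
    simp only [commutatorElement_def, mul_inv_rev]
    calc za * a * (zb * b) * (a⁻¹ * za⁻¹) * (b⁻¹ * zb⁻¹)
        = za * (a * zb) * b * a⁻¹ * (za⁻¹ * b⁻¹) * zb⁻¹ := by group
      _ = za * (zb * a) * b * a⁻¹ * (b⁻¹ * za⁻¹) * zb⁻¹ := by
        rw [(h2 a).eq, ((h1 b⁻¹).inv_left).eq]
      _ = (za * (zb * (a * b * a⁻¹ * b⁻¹))) * za⁻¹ * zb⁻¹ := by group
      _ = ((zb * (a * b * a⁻¹ * b⁻¹)) * za) * za⁻¹ * zb⁻¹ := by rw [(h1 _).eq]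
      _ = (zb * (a * b * a⁻¹ * b⁻¹)) * zb⁻¹ := by group
      _ = a * b * a⁻¹ * b⁻¹ := by rw [(h2 _).eq]; group
  rw [ea, eb, e2] at e1
  exact (mul_inv_eq_iff_eq_mul.mp e1).symm

theorem SubnormalDepth.iterCommutator_mem_of_le {Γ : Type*} [Group Γ] {r : ℕ} {G : Subgroup Γ}
    (hG : SubnormalDepth r G) (ms : List Γ) (hms : ∀ m ∈ ms, m ∈ G) (hlen : r ≤ ms.length)
    (x : Γ) : iterCommutator ms x ∈ G := by
  induction ms with
  | nil => exact hG.iterCommutator_mem [] hms (by simpa using hlen.antisymm' (by simp)) x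
  | cons m ms ih =>
    rcases hlen.eq_or_lt with h | h
    · exact hG.iterCommutator_mem _ hms h.symm x
    · have hw := ih (fun a ha => hms a (by simp [ha])) (by simpa using Nat.lt_succ_iff.mp h)
      have hm := hms m (by simp)
      exact G.mul_mem (G.mul_mem (G.mul_mem hw hm) (G.inv_mem hw)) (G.inv_mem hm)

theorem iterDiff_append_singleton {R : Type*} [Ring R] (ms : List Rˣ) (m : Rˣ) (y : R) :
    iterDiff (ms ++ [m]) y = iterDiff ms (y - m * y * (m⁻¹ : Rˣ)) := by
  induction ms with
  | nil => rfl
  | cons a ms ih => rw [List.cons_append, iterDiff, ih, iterDiff]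

theorem iterDiff_mul_of_commute {R : Type*} [Ring R] (ms : List Rˣ) {c : R}
    (hc : ∀ m ∈ ms, (m : R) * c = c * m) (y : R) :
    iterDiff ms (y * c) = iterDiff ms y * c := by
  induction ms with
  | nil => rfl
  | cons a ms ih =>
    rw [iterDiff, ih fun m hm => hc m (by simp [hm]), iterDiff, sub_mul]
    congr 1
    have : c * (a⁻¹ : Rˣ) = (a⁻¹ : Rˣ) * c := (Commute.units_inv_left (hc a (by simp))).symm
    simp only [mul_assoc, this]

theorem iterDiff_mem {R : Type*} [Ring R] (A : Subring R) (ms : List Rˣ)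
    (hms : ∀ m ∈ ms, (m : R) ∈ A ∧ ((m⁻¹ : Rˣ) : R) ∈ A) {y : R} (hy : y ∈ A) :
    iterDiff ms y ∈ A := by
  induction ms with
  | nil => exact hy
  | cons a ms ih =>
    have hv := ih fun m hm => hms m (by simp [hm])
    exact A.sub_mem hv (A.mul_mem (A.mul_mem (hms a (by simp)).1 hv) (hms a (by simp)).2)

/-- A subnormal subgroup acting unipotently by conjugation on a flag containing it is central. -/
theorem SubnormalDepth.le_center_of_flag (n : ℕ) {s : ℕ} {M : Subgroup Dˣ}
    (hM : SubnormalDepth s M) (V : ℕ → AddSubgroup D) (h0 : ∀ m ∈ M, (m : D) ∈ V 0)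
    (hanti : ∀ j, V (j + 1) ≤ V j)
    (hV : ∀ j, ∀ m ∈ M, ∀ v ∈ V j, v - m * v * (m⁻¹ : Dˣ) ∈ V (j + 1)) (hn : V n = ⊥) :
    M ≤ Subgroup.center Dˣ := by
  induction n generalizing s M V with
  | zero =>
    have := h0 1 M.one_mem
    rw [hn] at this
    simp at this
  | succ n ih =>
    cases n with
    | zero =>
      refine hM.le_center_of_commute fun a ha b hb => ?_
      have := hV 0 a ha b (h0 b hb)
      rw [hn, AddSubgroup.mem_bot, sub_eq_zero] at this
      ext
      rw [Units.val_mul, Units.val_mul]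
      conv_rhs => rw [this]
      simp [mul_assoc]
    | succ n =>
      have hconj : ∀ j, ∀ m ∈ M, ∀ v ∈ V j, (m : D) * v * (m⁻¹ : Dˣ) ∈ V j := by
        intro j m hm v hv
        have := (V j).sub_mem hv (hanti j (hV j m hm v hv))
        simpa using this
      let N : Subgroup Dˣ :=
        { carrier := {c | c ∈ M ∧ ∀ j, ∀ v ∈ V j, v - c * v * (c⁻¹ : Dˣ) ∈ V (j + 2)}
          one_mem' := ⟨M.one_mem, fun j v hv => by simp⟩
          mul_mem' := by
            rintro c d ⟨hc, hc'⟩ ⟨hd, hd'⟩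
            refine ⟨M.mul_mem hc hd, fun j v hv => ?_⟩
            have := (V (j + 2)).add_mem (hc' j v hv) (hconj _ c hc _ (hd' j v hv))
            convert this using 1
            simp only [mul_inv_rev, Units.val_mul]
            noncomm_ring
          inv_mem' := by
            rintro c ⟨hc, hc'⟩
            refine ⟨M.inv_mem hc, fun j v hv => ?_⟩
            have := (V (j + 2)).neg_mem (hconj _ c⁻¹ (M.inv_mem hc) _ (hc' j v hv))
            convert this using 1
            simp [mul_sub, sub_mul, mul_assoc] }
      have hNM : N ≤ M := fun c hc => hc.1
      have hNsub : SubnormalDepth (s + 1) N := by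
        refine ⟨M, hM, hNM, ?_⟩
        rintro c ⟨hc, hc'⟩ g hg
        refine ⟨M.mul_mem (M.mul_mem hg hc) (M.inv_mem hg), fun j v hv => ?_⟩
        have h1 := hconj j g⁻¹ (M.inv_mem hg) v hv
        have h2 := hconj _ g hg _ (hc' j _ h1)
        convert h2 using 1
        simp [mul_sub, sub_mul, mul_assoc]
      have hNc : N ≤ Subgroup.center Dˣ := by
        refine ih hNsub (fun j => if j = 0 then V 0 else V (j + 1)) ?_ ?_ ?_ ?_
        · intro m hm; simpa using h0 m (hNM hm)
        · intro j
          rcases j with _ | j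
          · simpa using (hanti 1).trans (hanti 0)
          · simpa using hanti (j + 2)
        · intro j m hm v hv
          rcases j with _ | j
          · simpa using hm.2 0 v (by simpa using hv)
          · simpa using hV (j + 2) m (hNM hm) v (by simpa using hv)
        · simpa using hn
      refine hM.le_center_of_commutator_central fun a ha b hb => hNc ⟨?_, ?_⟩
      · exact M.mul_mem (M.mul_mem (M.mul_mem ha hb) (M.inv_mem ha)) (M.inv_mem hb)
      · intro j v hv
        have hba := M.mul_mem hb ha
        have h1 := hconj j _ (M.inv_mem hba) v hv
        set v' := (((b * a)⁻¹ : Dˣ) : D) * v * (((b * a)⁻¹)⁻¹ : Dˣ) with hv'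
        have h2 := hV (j + 1) b hb _ (hV j a ha v' h1)
        have h3 := hV (j + 1) a ha _ (hV j b hb v' h1)
        have h4 := (V (j + 2)).sub_mem h2 h3
        have e1 : v = (b : D) * (a * v' * (a⁻¹ : Dˣ)) * (b⁻¹ : Dˣ) := by
          simp [hv', mul_assoc]
        have e2 : ((a * b * a⁻¹ * b⁻¹ : Dˣ) : D) * v * ((a * b * a⁻¹ * b⁻¹ : Dˣ)⁻¹ : Dˣ) =
            (a : D) * (b * v' * (b⁻¹ : Dˣ)) * (a⁻¹ : Dˣ) := by
          simp [hv', mul_assoc]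
        rw [e2, e1]
        convert h4 using 1
        noncomm_ring

theorem exists_eigenvector_of_finite_subring (T : Subring D) (hT : Finite T) {a b : D}
    (ha : a ∈ T) (hab : a * b ≠ b * a) (L : Subring D) (hTL : T ≤ L) (hb : b ∈ L) :
    ∃ e ∈ T, e ≠ a ∧ ∃ y ∈ L, y ≠ 0 ∧ y * a = e * y := by
  have hF := Finite.isDomain_to_isField T
  let _ : Field T := hF.toField
  let f : T →+* D :=
    { toFun := fun x => x
      map_one' := rfl
      map_mul' := fun _ _ => rfl
      map_zero' := rfl
      map_add' := fun _ _ => rfl }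
  have ha0 : (⟨a, ha⟩ : T) ≠ 0 := by
    intro h
    apply hab
    have : a = 0 := congrArg Subtype.val h
    simp [this]
  obtain ⟨e, he, y, hy, hy0, hya⟩ := exists_eigenvector_of_not_commute f (Units.mk0 _ ha0) b hab L
    (fun x => hTL x.2) hb
  exact ⟨(e : T), (e : T).2, fun h => he (Units.ext (Subtype.ext h)), y, hy, hy0, hya⟩

open Polynomial in
/-- If `K` is a division subring whose intersection with its centralizer is finite, and the
centralizer is noncommutative, then the latter contains an element transcendental over `K`. -/
theorem exists_twisted_transcendental (K : Subring D) (hinv : ∀ e ∈ K, e⁻¹ ∈ K)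
    (hfin : Finite ↥(K ⊓ Subring.centralizer (K : Set D))) {a b : D}
    (ha : a ∈ Subring.centralizer (K : Set D)) (hb : b ∈ Subring.centralizer (K : Set D))
    (hab : a * b ≠ b * a) :
    ∃ (l : Dˣ) (_ : (l : D) ∈ Subring.centralizer (K : Set D))
      (hE : ∀ e ∈ K, (l : D) * e * (l⁻¹ : Dˣ) ∈ K),
      ∀ p ∈ twistedPolynomials K l hE, p.eval 1 = 0 → p = 0 := by
  by_contra! hcon
  set L := Subring.centralizer (K : Set D) with hL
  set Z := K ⊓ L with hZ
  have hLc : ∀ x ∈ L, ∀ k ∈ K, k * x = x * k := fun x hx k hk => Subring.mem_centralizer_iff.mp hx k hk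
  have hconjL : ∀ l : Dˣ, (l : D) ∈ L → ∀ k ∈ K, (l : D) * k * (l⁻¹ : Dˣ) = k := by
    intro l hl k hk
    rw [← hLc l hl k hk]; simp
  have hinvL : ∀ l : Dˣ, (l : D) ∈ L → ((l⁻¹ : Dˣ) : D) ∈ L := by
    intro l hl
    rw [Units.val_inv_eq_inv_val]; exact Subring.inv_mem_centralizer hl
  have halg : ∀ l : Dˣ, (l : D) ∈ L → ∃ p : D[X], (∀ i, p.coeff i * ((l⁻¹ ^ i : Dˣ) : D) ∈ Z) ∧
      p.eval 1 = 0 ∧ 0 < p.natDegree ∧ p.leadingCoeff = ((l ^ p.natDegree : Dˣ) : D) := by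
    intro l hl
    have hE : ∀ e ∈ K, (l : D) * e * (l⁻¹ : Dˣ) ∈ K := fun e he => by rwa [hconjL l hl e he]
    obtain ⟨p, hp, hp1, hp0⟩ := hcon l hl hE
    obtain ⟨q, hq, hq1, hqd, hql, -, hrel⟩ := exists_minimal_twisted_relation hinv
      (fun e he => by
        have := hconjL l⁻¹ (hinvL l hl) e he
        rw [inv_inv] at this
        rwa [this]) ⟨p, hp, hp0, hp1⟩
    refine ⟨q, fun i => ⟨hq i, ?_⟩, hq1, hqd, hql⟩
    refine L.mul_mem ?_ (by rw [Units.val_pow_eq_pow_val]; exact L.pow_mem (hinvL l hl) i)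
    refine Subring.mem_centralizer_iff.mpr fun k hk => ?_
    rw [hrel k hk i]
    congr 1
    have h1 : ((l⁻¹ ^ q.natDegree : Dˣ) : D) ∈ L := by
      rw [Units.val_pow_eq_pow_val]; exact L.pow_mem (hinvL l hl) _
    rw [← hLc _ h1 k hk, mul_assoc, ← Units.val_mul]
    simp
  have hext : ∀ (T : Subring D), Finite T → Z ≤ T → ∀ l : Dˣ, (l : D) ∈ L →
      (∀ e ∈ T, (l : D) * e * (l⁻¹ : Dˣ) ∈ T) →
      Finite (Subring.closure ((T : Set D) ∪ {(l : D)})) := by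
    intro T hT hZT l hl hE
    obtain ⟨p, hp, hp1, hpd, hpl⟩ := halg l hl
    exact finite_closure_of_twisted_relation (hE := hE) hT (fun i => hZT (hp i)) hp1 hpd hpl
  have ha0 : a ≠ 0 := by rintro rfl; simp at hab
  have hT₀ := hext Z hfin le_rfl (Units.mk0 a ha0) ha (fun e he => by
    rw [hconjL (Units.mk0 a ha0) ha e he.1]; exact he)
  set T₀ := Subring.closure ((Z : Set D) ∪ {((Units.mk0 a ha0 : Dˣ) : D)}) with hT₀def
  have haT : a ∈ T₀ := Subring.subset_closure (Or.inr rfl)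
  have hT₀L : T₀ ≤ L := by
    rw [hT₀def, Subring.closure_le]
    rintro x (hx | hx)
    · exact hx.2
    · rw [Set.mem_singleton_iff] at hx; subst hx; exact ha
  obtain ⟨e, he, hea, y, hy, hy0, hya⟩ := exists_eigenvector_of_finite_subring T₀ hT₀ haT hab L hT₀L hb
  have hyT : ∀ x ∈ T₀, ((Units.mk0 y hy0 : Dˣ) : D) * x * ((Units.mk0 y hy0)⁻¹ : Dˣ) ∈ T₀ := by
    intro x hx
    induction hx using Subring.closure_induction with
    | mem x hx =>
      rcases hx with hx | hx
      · rw [hconjL (Units.mk0 y hy0) hy x hx.1]; exact Subring.subset_closure (Or.inl hx)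
      · rw [Set.mem_singleton_iff] at hx; rw [hx]
        have : ((Units.mk0 y hy0 : Dˣ) : D) * (Units.mk0 a ha0 : Dˣ) * ((Units.mk0 y hy0)⁻¹ : Dˣ) = e := by
          rw [Units.val_mk0, Units.val_mk0, hya]; simp [hy0]
        rw [this]; exact he
    | zero => simp [T₀.zero_mem]
    | one => rw [mul_one, Units.mul_inv]; exact T₀.one_mem
    | add x z _ _ hx hz => rw [mul_add, add_mul]; exact T₀.add_mem hx hz
    | neg x _ hx => rw [mul_neg, neg_mul]; exact T₀.neg_mem hx
    | mul x z _ _ hx hz =>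
      have := T₀.mul_mem hx hz
      simpa [mul_assoc, inv_mul_cancel_left₀ hy0] using this
  have hfin' := hext T₀ hT₀ (fun z hz => Subring.subset_closure (Or.inl hz)) (Units.mk0 y hy0) hy hyT
  have hcomm := mul_comm_of_finite_subring _ hfin' (x := y) (y := a)
    (Subring.subset_closure (Or.inr rfl)) (Subring.subset_closure (Or.inl haT))
  rw [hya] at hcomm
  exact hea (mul_right_cancel₀ hy0 hcomm)

open Polynomial in
theorem SubnormalDepth.iterDiff_eq_zero_of_commuting {r s : ℕ} {G M : Subgroup Dˣ}
    (hG : SubnormalDepth r G) (hM : SubnormalDepth s M)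
    (hcomm : ∀ g ∈ G, ∀ m ∈ M, g * m = m * g) (hGc : ¬ G ≤ Subgroup.center Dˣ) (ms : List Dˣ)
    (hms : ∀ m ∈ ms, m ∈ M) (hlen : s ≤ ms.length) {y : D}
    (hy : y ∈ Subring.centralizer ((fun u : Dˣ => (u : D)) '' (G : Set Dˣ))) :
    iterDiff ms y = 0 := by
  set K := Subring.centralizer ((fun u : Dˣ => (u : D)) '' (G : Set Dˣ)) with hK
  set L := Subring.centralizer (K : Set D) with hL
  have hGL : ∀ g ∈ G, (g : D) ∈ L := fun g hg => subset_centralizer_centralizer _ ⟨g, hg, rfl⟩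
  have hMK : ∀ m ∈ M, (m : D) ∈ K := by
    intro m hm
    rw [hK, Subring.mem_centralizer_iff]
    rintro _ ⟨g, hg, rfl⟩
    exact congrArg Units.val (hcomm g hg m hm)
  have hKinv : ∀ e ∈ K, e⁻¹ ∈ K := fun e he => Subring.inv_mem_centralizer he
  have hKL : ∀ x ∈ L, ∀ k ∈ K, k * x = x * k := fun x hx k hk => Subring.mem_centralizer_iff.mp hx k hk
  obtain ⟨g, hg, u, hu, hgu⟩ : ∃ g ∈ G, ∃ u ∈ G, g * u ≠ u * g := by
    by_contra! h
    exact hGc (hG.le_center_of_commute h)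
  have hgu' : (g : D) * u ≠ u * g := fun h => hgu (Units.ext h)
  by_cases hfin : Finite ↥(K ⊓ L)
  · obtain ⟨l, hl, hE, hinj⟩ := exists_twisted_transcendental K hKinv hfin (hGL g hg) (hGL u hu) hgu'
    have hE' : ∀ e ∈ K, ((l⁻¹ : Dˣ) : D) * e * l ∈ K := by
      intro e he
      rw [mul_assoc, hKL l hl e he]
      simpa using he
    obtain ⟨p, hp, q, hq, hp0, hq0, h1, heval⟩ := exists_iterCommutator_mul_eval_eq (hE := hE) hKinv
      hE' ms (fun m hm => hMK m (hms m hm)) (y := y * l) (by simpa using hy)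
    have hx0 : 1 + y * (l : D) * 1 ≠ 0 := by
      intro h0
      have hmem : (1 + C (y * (l : D)) * X ^ 1 : D[X]) ∈ twistedPolynomials K l hE :=
        Subring.add_mem _ (Subring.one_mem _)
          (C_mul_X_pow_mem_twistedPolynomials (by simpa using hy))
      have := hinj _ hmem (by simpa using h0)
      have := congrArg (fun r => coeff r 0) this
      simp at this
    have hw := hM.iterCommutator_mem_of_le ms hms hlen (Units.mk0 _ hx0)
    have hev := heval 1 (by simp) (by simp) (Units.mk0 _ hx0) rfl
    set w := iterCommutator ms (Units.mk0 _ hx0) with hwdef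
    have hz := hinj (C (w : D) * q - p) (Subring.sub_mem _ (Subring.mul_mem _
      (C_mem_twistedPolynomials (hMK w hw)) hq) hp) (by rw [eval_sub, eval_C_mul, hev, sub_self])
    have hw1 : (w : D) = 1 := by
      have := congrArg (fun r => coeff r 0) hz
      simpa [hp0, hq0, sub_eq_zero] using this
    have hqp : p.coeff 1 = q.coeff 1 := by
      have : q.coeff 1 - p.coeff 1 = 0 := by
        simpa [hw1] using congrArg (fun r => coeff r 1) hz
      exact (sub_eq_zero.mp this).symm
    rw [hqp, sub_self, iterDiff_mul_of_commute ms (fun m hm => hKL l hl m (hMK m (hms m hm)))] at h1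
    exact (mul_eq_zero.mp h1.symm).resolve_right l.ne_zero
  · set E := Subring.centralizer ((K ⊓ L : Subring D) : Set D) with hE
    have hKE : ∀ k ∈ K, k ∈ E := fun k hk => Subring.mem_centralizer_iff.mpr fun z hz =>
      (hKL z hz.2 k hk).symm
    have hGE : ∀ g ∈ G, (g : D) ∈ E := fun g hg => Subring.mem_centralizer_iff.mpr fun z hz =>
      hKL _ (hGL g hg) z hz.1
    have hEz : ∀ t ∈ K ⊓ L, ∀ e ∈ E, e * t = t * e := fun t ht e he =>
      (Subring.mem_centralizer_iff.mp he t ht).symm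
    obtain ⟨p, hp, q, hq, -, -, h1, heval⟩ := exists_iterCommutator_mul_eval_eq (E := E)
      (h := (1 : Dˣ)) (hE := by simp) (fun e he => Subring.inv_mem_centralizer he) (by simp)
      (u :: ms) (fun m hm => by
        rcases List.mem_cons.mp hm with rfl | hm
        · exact hGE _ hu
        · exact hKE _ (hMK m (hms m hm))) (y := y * g)
      (by simpa using E.mul_mem (hKE y hy) (hGE g hg))
    have hpqR := Subring.sub_mem _ hp hq
    have hpq : p - q = 0 := by
      have hSinf : (((K ⊓ L : Subring D) : Set D) \ {t | 1 + y * (g : D) * t = 0}).Infinite := by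
        refine Set.Infinite.sdiff (fun h => hfin h.to_subtype) (Set.Subsingleton.finite ?_)
        intro a ha b hb
        have ha' : 1 + y * (g : D) * a = 0 := ha
        have hb' : 1 + y * (g : D) * b = 0 := hb
        have hc : y * (g : D) ≠ 0 := by
          intro h0; rw [h0] at ha'; simp at ha'
        exact mul_left_cancel₀ hc (add_left_cancel (ha'.trans hb'.symm))
      refine eq_zero_of_infinite_commuting_roots hSinf
        (fun s hs t ht => hKL t ht.1.2 s hs.1.1) _ ?_ ?_
      · intro k
        rw [Subring.mem_centralizer_iff]
        intro t ht
        exact (commute_coeff_of_mem_twistedPolynomials hpqR (hEz t ht.1) (by simp) k).symm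
      · intro t ht
        have hev := heval t (hEz t ht.1) (by simp) (Units.mk0 _ ht.2) rfl
        have hw := hM.iterCommutator_mem_of_le ms hms hlen (Units.mk0 _ ht.2)
        rw [iterCommutator, ← hcomm u hu _ hw, mul_inv_cancel_right, mul_inv_cancel, Units.val_one,
          one_mul] at hev
        rw [eval_sub, hev, sub_self]
    have h2 : iterDiff (u :: ms) (y * g) = 0 := by
      rw [← h1, sub_eq_zero.mp hpq, sub_self]
    have hd : iterDiff ms y ∈ K := iterDiff_mem K ms (fun m hm =>
      ⟨hMK m (hms m hm), hMK m⁻¹ (M.inv_mem (hms m hm))⟩) hy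
    rw [iterDiff, iterDiff_mul_of_commute ms (fun m hm => hKL g (hGL g hg) m (hMK m (hms m hm))),
      ← mul_assoc (u : D), ← hKL u (hGL u hu) _ hd, mul_assoc _ (u : D), mul_assoc, ← mul_sub] at h2
    refine (mul_eq_zero.mp h2).resolve_right fun h3 => hgu' ?_
    rw [sub_eq_zero] at h3
    conv_lhs => rw [h3]
    simp

theorem SubnormalDepth.le_center_or_of_commuting {r s : ℕ} {G M : Subgroup Dˣ}
    (hG : SubnormalDepth r G) (hM : SubnormalDepth s M)
    (hcomm : ∀ g ∈ G, ∀ m ∈ M, g * m = m * g) (hGc : ¬ G ≤ Subgroup.center Dˣ) :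
    M ≤ Subgroup.center Dˣ := by
  set K := Subring.centralizer ((fun u : Dˣ => (u : D)) '' (G : Set Dˣ)) with hK
  have hMK : ∀ m ∈ M, (m : D) ∈ K := by
    intro m hm
    rw [hK, Subring.mem_centralizer_iff]
    rintro _ ⟨g, hg, rfl⟩
    exact congrArg Units.val (hcomm g hg m hm)
  let δ : List Dˣ → D →+ D := fun ms =>
    { toFun := iterDiff ms
      map_zero' := by
        induction ms with
        | nil => rfl
        | cons m ms ih => rw [iterDiff, ih]; simp
      map_add' := fun x y => by
        induction ms with
        | nil => rfl
        | cons m ms ih => simp only [iterDiff, ih]; noncomm_ring }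
  let V : ℕ → AddSubgroup D := fun j =>
    K.toAddSubgroup ⊓ ⨅ (ms : List Dˣ) (_ : (∀ m ∈ ms, m ∈ M) ∧ s ≤ ms.length + j), (δ ms).ker
  have hV : ∀ j v, v ∈ V j ↔ v ∈ K ∧ ∀ ms : List Dˣ, (∀ m ∈ ms, m ∈ M) → s ≤ ms.length + j →
      iterDiff ms v = 0 := by
    intro j v
    simp only [V, AddSubgroup.mem_inf, AddSubgroup.mem_iInf, AddMonoidHom.mem_ker, and_imp]
    rfl
  refine hM.le_center_of_flag s V ?_ ?_ ?_ ?_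
  · intro m hm
    rw [hV]
    exact ⟨hMK m hm, fun ms hms hlen => hG.iterDiff_eq_zero_of_commuting hM hcomm hGc ms hms hlen
      (hMK m hm)⟩
  · intro j v hv
    rw [hV] at hv ⊢
    exact ⟨hv.1, fun ms hms hlen => hv.2 ms hms (by omega)⟩
  · intro j m hm v hv
    rw [hV] at hv ⊢
    refine ⟨K.sub_mem hv.1 (K.mul_mem (K.mul_mem (hMK m hm) hv.1) (hMK m⁻¹ (M.inv_mem hm))), ?_⟩
    intro ms hms hlen
    rw [← iterDiff_append_singleton]
    refine hv.2 _ ?_ (by simp; omega)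
    intro a ha
    rcases List.mem_append.mp ha with ha | ha
    · exact hms a ha
    · rw [List.mem_singleton.mp ha]; exact hm
  · rw [eq_bot_iff]
    intro v hv
    rw [hV] at hv
    exact hv.2 [] (by simp) (by simp)

theorem Subgroup.conj_mem_commutator {Γ : Type*} [Group Γ] {H : Subgroup Γ} {y : Γ}
    (hy : ∀ x ∈ H, y * x * y⁻¹ ∈ H) {x : Γ} (hx : x ∈ ⁅H, H⁆) : y * x * y⁻¹ ∈ ⁅H, H⁆ := by
  have : ⁅H, H⁆ ≤ ⁅H, H⁆.comap (MulAut.conj y).toMonoidHom := by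
    rw [Subgroup.commutator_le]
    intro a ha b hb
    rw [Subgroup.mem_comap, map_commutatorElement]
    exact Subgroup.commutator_mem_commutator (hy a ha) (hy b hb)
  exact this hx

theorem SubnormalDepth.not_commutator_le_center {r : ℕ} {G : Subgroup Dˣ}
    (hG : SubnormalDepth r G) (hGc : ¬ G ≤ Subgroup.center Dˣ) :
    ¬ ⁅G, G⁆ ≤ Subgroup.center Dˣ := fun h =>
  hGc (hG.le_center_of_commutator_central fun _ ha _ hb =>
    h (Subgroup.commutator_mem_commutator ha hb))

theorem SubnormalDepth.mem_center_of_commute {r : ℕ} {G : Subgroup Dˣ}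
    (hG : SubnormalDepth r G) (hGc : ¬ G ≤ Subgroup.center Dˣ) {k : Dˣ}
    (hk : ∀ g ∈ G, g * k = k * g) : k ∈ Subgroup.center Dˣ := by
  induction r generalizing G k with
  | zero =>
    rw [SubnormalDepth] at hG
    subst hG
    exact Subgroup.mem_center_iff.mpr fun g => hk g trivial
  | succ r ih =>
    have hG' := hG
    obtain ⟨H, hH, hle, hconj⟩ := hG
    have hHc : ¬ H ≤ Subgroup.center Dˣ := fun h => hGc (hle.trans h)
    have hM : SubnormalDepth (r + 1) (H ⊓ Subgroup.centralizer (G : Set Dˣ)) := by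
      refine ⟨H, hH, inf_le_left, ?_⟩
      rintro x ⟨hx, hxc⟩ y hy
      refine ⟨H.mul_mem (H.mul_mem hy hx) (H.inv_mem hy), ?_⟩
      refine Subgroup.mem_centralizer_iff.mpr fun z hz => ?_
      have h1 := hconj z hz y⁻¹ (H.inv_mem hy)
      have h2 := congrArg (fun w => y * w * y⁻¹) (Subgroup.mem_centralizer_iff.mp hxc _ h1)
      simpa [mul_assoc] using h2
    have hQ : ∀ k ∈ H, (∀ g ∈ G, g * k = k * g) → k ∈ Subgroup.center Dˣ := by
      intro k hkH hk
      exact hG'.le_center_or_of_commuting hM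
        (fun g hg m hm => Subgroup.mem_centralizer_iff.mp hm.2 g hg) hGc
        ⟨hkH, Subgroup.mem_centralizer_iff.mpr hk⟩
    cases r with
    | zero =>
      rw [SubnormalDepth] at hH
      subst hH
      exact hQ k trivial hk
    | succ r =>
      have hHH : SubnormalDepth (r + 1) ⁅H, H⁆ := by
        obtain ⟨B, hB, hHB, hBconj⟩ := hH
        refine ⟨B, hB, ?_, fun x hx y hy =>
          Subgroup.conj_mem_commutator (fun z hz => hBconj z hz y hy) hx⟩
        rw [Subgroup.commutator_le]
        intro a ha b hb
        exact B.mul_mem (B.mul_mem (B.mul_mem (hHB ha) (hHB hb)) (B.inv_mem (hHB ha)))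
          (B.inv_mem (hHB hb))
      have hclimb : ∀ (j : ℕ) (B : Subgroup Dˣ), SubnormalDepth j B → H ≤ B →
          (∀ k ∈ B, (∀ g ∈ G, g * k = k * g) → k ∈ Subgroup.center Dˣ) →
          ∀ k, (∀ g ∈ G, g * k = k * g) → k ∈ Subgroup.center Dˣ := by
        intro j
        induction j with
        | zero =>
          intro B hB _ hQB k hk
          rw [SubnormalDepth] at hB
          subst hB
          exact hQB k trivial hk
        | succ j ihj =>
          rintro B ⟨B', hB', hBB', hconjB⟩ hHB hQB
          refine ihj B' hB' (hHB.trans hBB') ?_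
          intro k hkB hk
          have hcen : ∀ x ∈ H, k * x * k⁻¹ * x⁻¹ ∈ Subgroup.center Dˣ := by
            intro x hx
            refine hQB _ (B.mul_mem (hconjB x (hHB hx) k hkB) (B.inv_mem (hHB hx))) ?_
            intro g hg
            have hkc : k ∈ Subgroup.centralizer (G : Set Dˣ) := Subgroup.mem_centralizer_iff.mpr hk
            have h1 : x * k⁻¹ * x⁻¹ ∈ Subgroup.centralizer (G : Set Dˣ) := by
              refine Subgroup.mem_centralizer_iff.mpr fun z hz => ?_
              have h1 := hconj z hz x⁻¹ (H.inv_mem hx)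
              have h2 := congrArg (fun w => x * w * x⁻¹)
                (Subgroup.mem_centralizer_iff.mp (Subgroup.inv_mem _ hkc) _ h1)
              simpa [mul_assoc] using h2
            have h3 := Subgroup.mul_mem _ hkc h1
            have h4 := Subgroup.mem_centralizer_iff.mp h3 g hg
            simpa [mul_assoc] using h4
          have hle' : ⁅H, H⁆ ≤ Subgroup.centralizer {k} := by
            rw [Subgroup.commutator_le]
            intro a ha b hb
            rw [Subgroup.mem_centralizer_singleton_iff]
            exact commutatorElement_mul_comm_of_mem_center (hcen a ha) (hcen b hb)
          refine ih hHH (hH.not_commutator_le_center hHc) fun c hc => ?_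
          exact Subgroup.mem_centralizer_singleton_iff.mp (hle' hc)
      exact hclimb _ H hH le_rfl hQ k hk

theorem SubnormalDepth.mem_center_of_commute_commutator {r : ℕ} {G : Subgroup Dˣ}
    (hG : SubnormalDepth r G) (hGc : ¬ G ≤ Subgroup.center Dˣ) {k : Dˣ}
    (hk : ∀ a ∈ G, ∀ b ∈ G, ⁅a, b⁆ * k = k * ⁅a, b⁆) : k ∈ Subgroup.center Dˣ := by
  have hGG : SubnormalDepth (r + 1) ⁅G, G⁆ := by
    refine ⟨G, hG, ?_, fun x hx y hy => Subgroup.conj_mem_commutator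
      (fun z hz => G.mul_mem (G.mul_mem hy hz) (G.inv_mem hy)) hx⟩
    rw [Subgroup.commutator_le]
    intro a ha b hb
    exact G.mul_mem (G.mul_mem (G.mul_mem ha hb) (G.inv_mem ha)) (G.inv_mem hb)
  refine hGG.mem_center_of_commute (hG.not_commutator_le_center hGc) fun c hc => ?_
  have hle : ⁅G, G⁆ ≤ Subgroup.centralizer {k} := by
    rw [Subgroup.commutator_le]
    exact fun a ha b hb => Subgroup.mem_centralizer_singleton_iff.mpr (hk a ha b hb)
  exact Subgroup.mem_centralizer_singleton_iff.mp (hle hc)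

end groups

section involutions

theorem mul_involution_comm_of_traces {A : Type*} [Ring A] {σ : A → A}
    (hmul : ∀ x y, σ (x * y) = σ y * σ x) {x y : A} (hx : x + σ x ∈ Subring.center A)
    (hy : y + σ y ∈ Subring.center A) (hxy : x * y + σ (x * y) ∈ Subring.center A) :
    y * (x * σ x) = x * σ x * y := by
  rw [hmul] at hxy
  rw [Subring.mem_center_iff] at hx hy hxy
  obtain ⟨t, ht⟩ : ∃ t, t = x + σ x := ⟨_, rfl⟩
  obtain ⟨s, hs⟩ : ∃ s, s = y + σ y := ⟨_, rfl⟩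
  rw [← ht] at hx
  rw [← hs] at hy
  obtain hσx : σ x = t - x := by rw [ht]; abel
  obtain hσy : σ y = s - y := by rw [hs]; abel
  have h1 := sub_eq_zero.mpr (hxy x).symm
  have h2 := sub_eq_zero.mpr (hx y).symm
  have h3 := sub_eq_zero.mpr (hx x).symm
  have h4 := sub_eq_zero.mpr (hy x).symm
  rw [hσx, hσy] at h1
  rw [hσx]
  refine (sub_eq_zero.mp ?_).symm
  calc x * (t - x) * y - y * (x * (t - x))
      = ((x * y + (s - y) * (t - x)) * x - x * (x * y + (s - y) * (t - x))) + x * (t * y - y * t)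
        + y * (t * x - x * t) + (s * x - x * s) * x - s * (t * x - x * t)
        - (s * x - x * s) * t := by noncomm_ring
    _ = 0 := by rw [h1, h2, h3, h4]; simp

theorem norm_mem_center_of_trace_mem_center {A : Type*} [Ring A] {σ : A → A}
    (hmul : ∀ x y, σ (x * y) = σ y * σ x) (h : ∀ x, x + σ x ∈ Subring.center A) (x : A) :
    x * σ x ∈ Subring.center A :=
  Subring.mem_center_iff.mpr fun y => mul_involution_comm_of_traces hmul (h x) (h y) (h (x * y))

theorem trace_mem_center_of_norm_mem_center {A : Type*} [Ring A] {σ : A → A}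
    (hadd : ∀ x y, σ (x + y) = σ x + σ y) (hone : σ 1 = 1)
    (h : ∀ x, x * σ x ∈ Subring.center A) (x : A) : x + σ x ∈ Subring.center A := by
  have h1 := Subring.sub_mem _ (Subring.sub_mem _ (h (1 + x)) (h x)) (Subring.one_mem _)
  have h2 : (1 + x) * σ (1 + x) - x * σ x - 1 = x + σ x := by
    rw [hadd, hone]; noncomm_ring
  rwa [h2] at h1

theorem mul_conj_mem_center_of_norm_mem_center {Γ : Type*} [Group Γ] {s : Γ → Γ}
    (hs : ∀ a b, s (a * b) = s b * s a) {g h : Γ} (hg : g * s g ∈ Subgroup.center Γ)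
    (hgh : h * g * h⁻¹ * s (h * g * h⁻¹) ∈ Subgroup.center Γ) :
    s h * h * g * (s h * h)⁻¹ * g⁻¹ ∈ Subgroup.center Γ := by
  have hs1 : s 1 = 1 := by simpa using hs 1 1
  have hinv : s h⁻¹ = (s h)⁻¹ := eq_inv_of_mul_eq_one_left (by rw [← hs, mul_inv_cancel, hs1])
  rw [hs, hs, hinv] at hgh
  set z := h * g * h⁻¹ * ((s h)⁻¹ * (s g * s h)) with hz
  set m := g * s g with hm
  have hsg : s g = g⁻¹ * m := by rw [hm]; group
  have hzm := Subgroup.mul_mem _ hgh (Subgroup.inv_mem _ hg)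
  have key : s h * h * g * (s h * h)⁻¹ * g⁻¹ = z * m⁻¹ := by
    calc s h * h * g * (s h * h)⁻¹ * g⁻¹ = s h * z * (s h)⁻¹ * m⁻¹ := by rw [hz, hsg]; group
      _ = z * m⁻¹ := by rw [Subgroup.mem_center_iff.mp hgh]; group
  rwa [key]

end involutions

section divisionRing
variable {D : Type*} [DivisionRing D]

theorem Units.val_mem_center {u : Dˣ} (hu : u ∈ Subgroup.center Dˣ) :
    (u : D) ∈ Subring.center D := by
  refine Subring.mem_center_iff.mpr fun y => ?_
  rcases eq_or_ne y 0 with rfl | hy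
  · simp
  · exact congrArg Units.val (Subgroup.mem_center_iff.mp hu (Units.mk0 y hy))

theorem Units.mem_center_of_val {R : Type*} [Ring R] {u : Rˣ}
    (hu : (u : R) ∈ Subring.center R) : u ∈ Subgroup.center Rˣ :=
  Subgroup.mem_center_iff.mpr fun v => Units.ext (Subring.mem_center_iff.mp hu v)

theorem SubnormalDepth.norm_mem_center_of_trace {r : ℕ} {G : Subgroup Dˣ}
    (hG : SubnormalDepth r G) (hGc : ¬ G ≤ Subgroup.center Dˣ) {σ : D → D}
    (hmul : ∀ x y, σ (x * y) = σ y * σ x) (h0 : ∀ x, σ x = 0 → x = 0)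
    (h : ∀ g ∈ G, (g : D) + σ g ∈ Subring.center D) :
    ∀ g ∈ G, (g : D) * σ g ∈ Subring.center D := by
  intro g hg
  have hne : (g : D) * σ g ≠ 0 := mul_ne_zero g.ne_zero fun h => g.ne_zero (h0 _ h)
  refine Units.val_mem_center (u := Units.mk0 _ hne) (hG.mem_center_of_commute hGc fun a ha => ?_)
  exact Units.ext (mul_involution_comm_of_traces hmul (h g hg) (h a ha) (h _ (G.mul_mem hg ha)))

theorem SubnormalDepth.norm_mem_center {r : ℕ} {G : Subgroup Dˣ}
    (hG : SubnormalDepth r G) (hGc : ¬ G ≤ Subgroup.center Dˣ) {σ : D → D}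
    (hmul : ∀ x y, σ (x * y) = σ y * σ x) (h0 : ∀ x, σ x = 0 ↔ x = 0)
    (h : ∀ g ∈ G, (g : D) * σ g ∈ Subring.center D) (x : D) :
    x * σ x ∈ Subring.center D := by
  obtain ⟨s, hsσ⟩ : ∃ s : Dˣ → Dˣ, ∀ u, (s u : D) = σ u :=
    ⟨fun u => Units.mk0 (σ u) fun h => u.ne_zero ((h0 _).mp h), fun _ => rfl⟩
  have hs : ∀ a b, s (a * b) = s b * s a := fun a b => Units.ext (by simp [hsσ, hmul])
  have hunit : ∀ u ∈ (⊤ : Subgroup Dˣ), u * s u ∈ Subgroup.center Dˣ := by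
    have hG' : ∀ g ∈ G, g * s g ∈ Subgroup.center Dˣ := fun g hg =>
      Units.mem_center_of_val (by simpa [hsσ] using h g hg)
    clear h
    induction r generalizing G with
    | zero => rw [SubnormalDepth] at hG; rwa [hG] at hG'
    | succ r ih =>
      obtain ⟨H, hH, hle, hconj⟩ := id hG
      refine ih hH (fun h => hGc (hle.trans h)) fun u hu => ?_
      have hk : s u * u ∈ Subgroup.center Dˣ := hG.mem_center_of_commute_commutator hGc
        fun a ha b hb => commutatorElement_mul_comm_of_mem_center
          (mul_conj_mem_center_of_norm_mem_center hs (hG' a ha) (hG' _ (hconj a ha u hu)))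
          (mul_conj_mem_center_of_norm_mem_center hs (hG' b hb) (hG' _ (hconj b hb u hu)))
      have e : u * s u = s u * u := by
        have := Subgroup.mem_center_iff.mp hk u
        rw [← mul_assoc] at this
        exact mul_right_cancel this
      rwa [e]
  rcases eq_or_ne x 0 with rfl | hx
  · simp
  · simpa [hsσ] using Units.val_mem_center (hunit (Units.mk0 x hx) trivial)

end divisionRing

section transvections
open Matrix
variable {ι D : Type*} [Fintype ι] [DecidableEq ι] [DivisionRing D]

theorem single_mul_apply_eq_ite {R : Type*} [Ring R] (i j : ι) (a : R) (M : Matrix ι ι R)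
    (p q : ι) : (single i j a * M) p q = if p = i then a * M j q else 0 := by
  split_ifs with h
  · subst h; simp
  · simp [h]

theorem mul_single_apply_eq_ite {R : Type*} [Ring R] (i j : ι) (a : R) (M : Matrix ι ι R)
    (p q : ι) : (M * single i j a) p q = if q = j then M p i * a else 0 := by
  split_ifs with h
  · subst h; simp
  · simp [h]

/-- The unit `1 + a E_ij` of the matrix ring, for `i ≠ j`. -/
def transvectionUnit {R : Type*} [Ring R] {i j : ι} (h : i ≠ j) (a : R) : (Matrix ι ι R)ˣ where
  val := 1 + single i j a
  inv := 1 - single i j a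
  val_inv := by simp [add_mul, mul_sub, h.symm]
  inv_val := by simp [sub_mul, mul_add, h.symm]

theorem val_transvectionUnit {R : Type*} [Ring R] {i j : ι} (h : i ≠ j) (a : R) :
    ((transvectionUnit h a : (Matrix ι ι R)ˣ) : Matrix ι ι R) = 1 + single i j a := rfl

theorem val_inv_transvectionUnit {R : Type*} [Ring R] {i j : ι} (h : i ≠ j) (a : R) :
    (((transvectionUnit h a)⁻¹ : (Matrix ι ι R)ˣ) : Matrix ι ι R) = 1 - single i j a := rfl

variable (ι D) in
/-- The set of all transvections in `GL_ι(D)`. -/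
def transvectionUnits : Set (Matrix ι ι D)ˣ :=
  {u | ∃ (i j : ι) (h : i ≠ j) (a : D), u = transvectionUnit h a}

/-- The transvections whose nontrivial entry is in row `j`. -/
def rowTransvectionUnits (D : Type*) [DivisionRing D] (j : ι) : Set (Matrix ι ι D)ˣ :=
  {u | ∃ (k : ι) (h : j ≠ k) (a : D), u = transvectionUnit h a}

theorem rowTransvectionUnits_subset (j : ι) :
    rowTransvectionUnits D j ⊆ transvectionUnits ι D :=
  fun _ ⟨k, h, a, hu⟩ => ⟨j, k, h, a, hu⟩

theorem exists_row_unipotent (j : ι) (f : ι → D) (hf : f j = 0) :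
    ∃ u ∈ Subgroup.closure (rowTransvectionUnits D j), ∀ p q, (u : Matrix ι ι D) p q =
      (1 : Matrix ι ι D) p q + if p = j then f q else 0 := by
  have key : ∀ s : Finset ι, j ∉ s → ∃ u ∈ Subgroup.closure (rowTransvectionUnits D j),
      ∀ p q, (u : Matrix ι ι D) p q =
        (1 : Matrix ι ι D) p q + if p = j ∧ q ∈ s then f q else 0 := by
    intro s
    induction s using Finset.induction_on with
    | empty => exact fun _ => ⟨1, Subgroup.one_mem _, by simp⟩
    | insert k s hk ih =>
      intro hj
      rw [Finset.mem_insert, not_or] at hj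
      obtain ⟨u, hu, huv⟩ := ih hj.2
      refine ⟨u * transvectionUnit hj.1 (f k), Subgroup.mul_mem _ hu
        (Subgroup.subset_closure ⟨k, hj.1, _, rfl⟩), fun p q => ?_⟩
      rw [Units.val_mul, val_transvectionUnit, mul_add, mul_one, Matrix.add_apply,
        mul_single_apply_eq_ite, huv, huv]
      by_cases hp : p = j
      · subst hp
        by_cases hq : q = k
        · subst hq; simp [hj.1, hk, hj.2]
        · simp [hq]
      · simp [hp]
  obtain ⟨u, hu, huv⟩ := key (Finset.univ.erase j) (by simp)
  refine ⟨u, hu, fun p q => ?_⟩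
  rw [huv]
  by_cases hp : p = j <;> by_cases hq : q = j <;> simp [hp, hq, hf]

theorem exists_column_unipotent (i : ι) (v : ι → D) (hv : v i = 0) :
    ∃ u ∈ Subgroup.closure (transvectionUnits ι D), ∀ p q, (u : Matrix ι ι D) p q =
      (1 : Matrix ι ι D) p q + if q = i then v p else 0 := by
  have key : ∀ s : Finset ι, i ∉ s → ∃ u ∈ Subgroup.closure (transvectionUnits ι D),
      ∀ p q, (u : Matrix ι ι D) p q =
        (1 : Matrix ι ι D) p q + if q = i ∧ p ∈ s then v p else 0 := by
    intro s
    induction s using Finset.induction_on with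
    | empty => exact fun _ => ⟨1, Subgroup.one_mem _, by simp⟩
    | insert k s hk ih =>
      intro hi
      rw [Finset.mem_insert, not_or] at hi
      obtain ⟨u, hu, huv⟩ := ih hi.2
      refine ⟨transvectionUnit (Ne.symm hi.1) (v k) * u, Subgroup.mul_mem _
        (Subgroup.subset_closure ⟨k, i, Ne.symm hi.1, _, rfl⟩) hu, fun p q => ?_⟩
      rw [Units.val_mul, val_transvectionUnit, add_mul, one_mul, Matrix.add_apply,
        single_mul_apply_eq_ite, huv, huv]
      by_cases hq : q = i
      · subst hq
        by_cases hp : p = k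
        · subst hp; simp [hk, hi.2]
        · simp [hp]
      · have hq' : i ≠ q := Ne.symm hq
        simp [hq, hq']
  obtain ⟨u, hu, huv⟩ := key (Finset.univ.erase i) (by simp)
  refine ⟨u, hu, fun p q => ?_⟩
  rw [huv]
  by_cases hp : p = i <;> by_cases hq : q = i <;> simp [hp, hq, hv]

theorem rowTransvectionUnits_commute {j : ι} {x y : (Matrix ι ι D)ˣ}
    (hx : x ∈ Subgroup.closure (rowTransvectionUnits D j))
    (hy : y ∈ Subgroup.closure (rowTransvectionUnits D j)) : x * y = y * x := by
  have := Subgroup.isMulCommutative_closure (k := rowTransvectionUnits D j) (by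
    rintro _ ⟨k, h, a, rfl⟩ _ ⟨l, h', b, rfl⟩
    ext1
    simp only [Units.val_mul, val_transvectionUnit, add_mul, mul_add, one_mul, mul_one]
    rw [single_mul_single_of_ne _ _ _ _ h.symm, single_mul_single_of_ne _ _ _ _ h'.symm]
    abel)
  exact setLike_mul_comm hx hy

/-- If a subgroup is normalised by `closure X` and every element of `X` is congruent modulo it to
an element of an abelian subgroup of `closure X`, then it contains the commutators of
`closure X`. -/
theorem commutator_mem_of_mem_mul {Γ : Type*} [Group Γ] {X : Set Γ} {G U : Subgroup Γ}
    (hU : U ≤ Subgroup.closure X) (hUc : ∀ u ∈ U, ∀ v ∈ U, u * v = v * u)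
    (hG : ∀ e ∈ Subgroup.closure X, ∀ g ∈ G, e * g * e⁻¹ ∈ G)
    (hX : ∀ x ∈ X, ∃ u ∈ U, x * u⁻¹ ∈ G) {x y : Γ} (hx : x ∈ Subgroup.closure X)
    (hy : y ∈ Subgroup.closure X) : x * y * x⁻¹ * y⁻¹ ∈ G := by
  have key : ∀ x ∈ Subgroup.closure X, ∃ u ∈ U, ∃ g ∈ G, x = g * u := by
    intro x hx
    induction hx using Subgroup.closure_induction with
    | mem x hx =>
      obtain ⟨u, hu, hg⟩ := hX x hx
      exact ⟨u, hu, _, hg, by group⟩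
    | one => exact ⟨1, U.one_mem, 1, G.one_mem, by group⟩
    | mul x y _ _ hx hy =>
      obtain ⟨u, hu, g, hg, rfl⟩ := hx
      obtain ⟨v, hv, k, hk, rfl⟩ := hy
      exact ⟨u * v, U.mul_mem hu hv, _, G.mul_mem hg (hG u (hU hu) k hk), by group⟩
    | inv x _ hx =>
      obtain ⟨u, hu, g, hg, rfl⟩ := hx
      exact ⟨u⁻¹, U.inv_mem hu, _, hG _ (hU (U.inv_mem hu)) _ (G.inv_mem hg), by group⟩
  obtain ⟨u, hu, g, hg, rfl⟩ := key x hx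
  obtain ⟨v, hv, k, hk, rfl⟩ := key y hy
  have h1 := G.mul_mem (G.mul_mem hg (hG u (hU hu) k hk))
    (G.inv_mem (G.mul_mem hk (hG v (hU hv) g hg)))
  have h2 : g * (u * k * u⁻¹) * (k * (v * g * v⁻¹))⁻¹ =
      g * u * k * (u⁻¹ * (v * g⁻¹ * v⁻¹)) * k⁻¹ := by group
  have h3 : g * u * (k * v) * (g * u)⁻¹ * (k * v)⁻¹ =
      g * u * k * ((v * u⁻¹) * g⁻¹ * v⁻¹) * k⁻¹ := by group
  rw [h3, ← hUc _ (U.inv_mem hu) v hv]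
  rw [h2] at h1
  simpa only [mul_assoc] using h1

theorem exists_offDiagonal_ne_zero [Nontrivial ι] {G : Subgroup (Matrix ι ι D)ˣ}
    (hGc : ¬ G ≤ Subgroup.center _)
    (hG : ∀ e ∈ Subgroup.closure (transvectionUnits ι D), ∀ g ∈ G, e * g * e⁻¹ ∈ G) :
    ∃ g ∈ G, ∃ k j : ι, k ≠ j ∧ (g : Matrix ι ι D) k j ≠ 0 := by
  by_contra! hd
  refine hGc fun g hg => Units.mem_center_of_val (Subring.mem_center_iff.mpr fun y => ?_)
  have h1 : ∀ i j : ι, i ≠ j → ∀ a : D,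
      (g : Matrix ι ι D) i i * a = a * (g : Matrix ι ι D) j j := by
    intro i j hij a
    have hh := hG (transvectionUnit hij a) (Subgroup.subset_closure ⟨i, j, hij, a, rfl⟩) g hg
    obtain ⟨h, hh', heq⟩ : ∃ h ∈ G, transvectionUnit hij a * g = h * transvectionUnit hij a :=
      ⟨_, hh, by group⟩
    have heq' := congrArg Units.val heq
    simp only [Units.val_mul, val_transvectionUnit, add_mul, mul_add, one_mul, mul_one] at heq'
    have e1 := congrFun (congrFun heq' i) j
    have e2 := congrFun (congrFun heq' i) i
    simp only [Matrix.add_apply, single_mul_apply_eq_ite, mul_single_apply_eq_ite, if_true,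
      hd g hg i j hij, hd g hg j i hij.symm, hd h hh' i j hij, if_neg hij, zero_add, add_zero,
      mul_zero] at e1 e2
    rw [e1, e2]
  have h2 : ∀ (i j : ι) (a : D), (g : Matrix ι ι D) i i * a = a * (g : Matrix ι ι D) j j := by
    intro i j a
    rcases eq_or_ne i j with rfl | hij
    · obtain ⟨k, hk⟩ := exists_ne i
      have := h1 i k hk.symm 1
      rw [h1 i k hk.symm a, ← one_mul ((g : Matrix ι ι D) k k), ← this, mul_one]
    · exact h1 i j hij a
  have hg' : (g : Matrix ι ι D) = diagonal fun i => (g : Matrix ι ι D) i i := by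
    ext p q
    rcases eq_or_ne p q with rfl | hpq
    · simp
    · simp [hpq, hd g hg p q hpq]
  rw [hg']
  ext p q
  rw [diagonal_mul, mul_diagonal, h2]

theorem transvectionUnits_subset_of_normalizes [Nontrivial ι] {G : Subgroup (Matrix ι ι D)ˣ}
    (hGc : ¬ G ≤ Subgroup.center _)
    (hG : ∀ e ∈ Subgroup.closure (transvectionUnits ι D), ∀ g ∈ G, e * g * e⁻¹ ∈ G)
    {s : D} (hs : s ∈ Subring.center D) (hs0 : s ≠ 0) (hs1 : s * s ≠ 1) :
    transvectionUnits ι D ⊆ G := by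
  have hmem : ∀ {i j : ι} (h : i ≠ j) (a : D),
      transvectionUnit h a ∈ Subgroup.closure (transvectionUnits ι D) :=
    fun h a => Subgroup.subset_closure ⟨_, _, h, a, rfl⟩
  obtain ⟨g₀, hg₀, k, j, hkj, hg₀kj⟩ := exists_offDiagonal_ne_zero hGc hG
  have hent : ∀ i, i ≠ j → ∃ g ∈ G, (g : Matrix ι ι D) i j ≠ 0 := by
    intro i hij
    by_cases h0 : (g₀ : Matrix ι ι D) i j = 0
    · have hik : i ≠ k := by rintro rfl; exact hg₀kj h0
      refine ⟨_, hG _ (hmem hik 1) _ hg₀, ?_⟩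
      rw [Units.val_mul, Units.val_mul, val_transvectionUnit, val_inv_transvectionUnit, mul_sub,
        mul_one, Matrix.sub_apply, mul_single_apply_eq_ite, if_neg hkj.symm, sub_zero, add_mul,
        one_mul, Matrix.add_apply, single_mul_apply_eq_ite, if_pos rfl, h0, zero_add, one_mul]
      exact hg₀kj
    · exact ⟨g₀, hg₀, h0⟩
  have hcol : ∀ i, i ≠ j → ∃ g ∈ G, (g : Matrix ι ι D) i j ≠ 0 ∧
      ∀ p, p ≠ i → (g : Matrix ι ι D) p j = 0 := by
    intro i hij
    obtain ⟨g, hg, hgij⟩ := hent i hij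
    obtain ⟨c, hc, hcv⟩ := exists_column_unipotent i
      (fun p => if p = i then 0 else - ((g : Matrix ι ι D) p j * ((g : Matrix ι ι D) i j)⁻¹))
      (by simp)
    obtain ⟨h, hh, heq⟩ : ∃ h ∈ G, c * g = h * c := ⟨_, hG c hc g hg, by group⟩
    have hhj : ∀ p, (h : Matrix ι ι D) p j = ((c * g : (Matrix ι ι D)ˣ) : Matrix ι ι D) p j := by
      intro p
      rw [heq, Units.val_mul, Matrix.mul_apply, Finset.sum_eq_single j]
      · simp [hcv, hij.symm]
      · intro q _ hq
        simp [hcv, hij.symm, hq]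
      · simp
    have hcg : ∀ p, ((c * g : (Matrix ι ι D)ˣ) : Matrix ι ι D) p j = (g : Matrix ι ι D) p j +
        (if p = i then 0 else - ((g : Matrix ι ι D) p j * ((g : Matrix ι ι D) i j)⁻¹)) *
          (g : Matrix ι ι D) i j := by
      intro p
      rw [Units.val_mul, Matrix.mul_apply]
      simp only [hcv, add_mul, Finset.sum_add_distrib, ite_mul, zero_mul, Finset.sum_ite_eq',
        Finset.mem_univ, if_true]
      rw [← Matrix.mul_apply, one_mul]
    refine ⟨h, hh, ?_, fun p hp => ?_⟩
    · rw [hhj, hcg]; simpa using hgij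
    · rw [hhj, hcg, if_neg hp]; simp [hgij]
  have hX : ∀ x ∈ transvectionUnits ι D,
      ∃ u ∈ Subgroup.closure (rowTransvectionUnits D j), x * u⁻¹ ∈ G := by
    rintro _ ⟨i, l, hil, a, rfl⟩
    rcases eq_or_ne i j with rfl | hij
    · exact ⟨_, Subgroup.subset_closure ⟨l, hil, a, rfl⟩, by simp [G.one_mem]⟩
    obtain ⟨g, hg, hgij, hgj⟩ := hcol i hij
    obtain ⟨u, hu, huv⟩ := exists_row_unipotent j
      (fun q => ((g : Matrix ι ι D) i j)⁻¹ * (a * (g : Matrix ι ι D) l q))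
      (by simp [hgj l hil.symm])
    have heq : transvectionUnit hil a * g = g * u := by
      ext p q
      rw [Units.val_mul, Units.val_mul, val_transvectionUnit, add_mul, one_mul, Matrix.add_apply,
        single_mul_apply_eq_ite, Matrix.mul_apply]
      simp only [huv, mul_add, Finset.sum_add_distrib, mul_ite, mul_zero, Finset.sum_ite_eq',
        Finset.mem_univ, if_true]
      rw [← Matrix.mul_apply, mul_one]
      congr 1
      split_ifs with hp
      · rw [hp, mul_inv_cancel_left₀ hgij]
      · rw [hgj p hp, zero_mul]
    refine ⟨u, hu, ?_⟩
    have h1 := hG u (Subgroup.closure_mono (rowTransvectionUnits_subset j) hu) _ (G.inv_mem hg)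
    have h2 : transvectionUnit hil a * u⁻¹ = g * (u * g⁻¹ * u⁻¹) := by
      rw [eq_mul_inv_of_mul_eq heq]; group
    rw [h2]
    exact G.mul_mem hg h1
  have hcomm : ∀ x ∈ Subgroup.closure (transvectionUnits ι D),
      ∀ y ∈ Subgroup.closure (transvectionUnits ι D), x * y * x⁻¹ * y⁻¹ ∈ G :=
    fun x hx y hy => commutator_mem_of_mem_mul
      (Subgroup.closure_mono (rowTransvectionUnits_subset j))
      (fun u hu v hv => rowTransvectionUnits_commute hu hv) hG hX hx hy
  have hweyl : ∀ {p q : ι} (h : p ≠ q) (a z : D), z ∈ Subring.center D → z ≠ 0 →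
      transvectionUnit h.symm (-(z⁻¹ * z⁻¹ * a)) * (transvectionUnit h a)⁻¹ ∈ G := by
    intro p q h a z hz hz0
    set w := transvectionUnit h z * transvectionUnit h.symm (-z⁻¹) * transvectionUnit h z with hw
    have hwE : w ∈ Subgroup.closure (transvectionUnits ι D) :=
      Subgroup.mul_mem _ (Subgroup.mul_mem _ (hmem _ _) (hmem _ _)) (hmem _ _)
    have heq : w * transvectionUnit h a = transvectionUnit h.symm (-(z⁻¹ * z⁻¹ * a)) * w := by
      have hza : a * z = z * a := Subring.mem_center_iff.mp hz a
      ext1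
      simp only [hw, Units.val_mul, val_transvectionUnit, add_mul, mul_add, one_mul, mul_one,
        single_mul_single_same, single_mul_single_of_ne _ _ _ _ h,
        single_mul_single_of_ne _ _ _ _ h.symm, add_zero, mul_neg, neg_mul, mul_assoc,
        inv_mul_cancel₀ hz0, mul_inv_cancel₀ hz0, hza, inv_mul_cancel_left₀ hz0,
        mul_inv_cancel_left₀ hz0]
      simp only [← single_neg]
      abel
    have := hcomm w hwE _ (hmem h a)
    rwa [heq, mul_inv_cancel_right] at this
  rintro _ ⟨p, q, h, a, rfl⟩
  have key : ∀ b : D, transvectionUnit h (b - s⁻¹ * s⁻¹ * b) ∈ G := by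
    intro b
    have h1 := G.mul_mem (G.inv_mem (hweyl h b s hs hs0))
      (hweyl h (s⁻¹ * s⁻¹ * b) 1 (Subring.one_mem _) one_ne_zero)
    have h2 : (transvectionUnit h (b - s⁻¹ * s⁻¹ * b) : (Matrix ι ι D)ˣ) =
        transvectionUnit h b * (transvectionUnit h (s⁻¹ * s⁻¹ * b))⁻¹ := by
      ext1
      rw [Units.val_mul, val_transvectionUnit, val_transvectionUnit, val_inv_transvectionUnit,
        mul_sub, mul_one, add_mul, single_mul_single_of_ne _ _ _ _ h.symm, sub_eq_add_neg b,
        single_add, ← single_neg]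
      noncomm_ring
    rw [h2]
    simpa [mul_assoc] using h1
  have hs2 : 1 - s⁻¹ * s⁻¹ ≠ 0 := by
    rw [sub_ne_zero, ne_comm, ← _root_.mul_inv_rev, Ne, inv_eq_one]
    exact hs1
  have := key ((1 - s⁻¹ * s⁻¹)⁻¹ * a)
  rwa [← one_sub_mul, mul_inv_cancel_left₀ hs2] at this

theorem SubnormalDepth.transvectionUnits_subset [Nontrivial ι] {r : ℕ}
    {G : Subgroup (Matrix ι ι D)ˣ} (hG : SubnormalDepth r G) (hGc : ¬ G ≤ Subgroup.center _)
    {s : D} (hs : s ∈ Subring.center D) (hs0 : s ≠ 0) (hs1 : s * s ≠ 1) :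
    transvectionUnits ι D ⊆ G := by
  induction r generalizing G with
  | zero => rw [SubnormalDepth] at hG; simp [hG]
  | succ r ih =>
    obtain ⟨H, hH, hle, hconj⟩ := hG
    have hEH := ih hH fun h => hGc (hle.trans h)
    exact transvectionUnits_subset_of_normalizes hGc
      (fun e he g hg => hconj g hg e ((Subgroup.closure_le H).mpr hEH he)) hs hs0 hs1

end transvections

section matrixInvolutions
open Matrix
variable {ι D : Type*} [Fintype ι] [DecidableEq ι] [DivisionRing D]

theorem eq_zero_of_scalar_sub_single_sq {i j : ι} (h : i ≠ j) {b d : D}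
    (hsq : (scalar ι b - single i j d) * (scalar ι b - single i j d) = 0) : b = 0 := by
  have := congrFun (congrFun hsq i) i
  simpa [sub_mul, mul_sub, h.symm, h, scalar_apply, single_mul_apply_eq_ite,
    mul_single_apply_eq_ite] using this

variable {σ : Matrix ι ι D → Matrix ι ι D}

theorem involution_single_sq (hadd : ∀ x y, σ (x + y) = σ x + σ y)
    (hmul : ∀ x y, σ (x * y) = σ y * σ x) {i j : ι} (h : i ≠ j) (a : D) :
    σ (single i j a) * σ (single i j a) = 0 := by
  have h0 : σ 0 = 0 := by simpa using hadd 0 0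
  rw [← hmul, single_mul_single_of_ne _ _ _ _ h.symm, h0]

theorem involution_single_of_trace (hadd : ∀ x y, σ (x + y) = σ x + σ y)
    (hmul : ∀ x y, σ (x * y) = σ y * σ x) (hone : σ 1 = 1) {i j : ι} (h : i ≠ j) (a : D)
    (hc : 1 + single i j a + σ (1 + single i j a) ∈ Subring.center (Matrix ι ι D)) :
    σ (single i j a) = - single i j a := by
  have hsq := involution_single_sq hadd hmul h a
  have hc' := Subring.sub_mem _ hc (Subring.add_mem _ (Subring.one_mem _) (Subring.one_mem _))
  rw [subringCenter_eq_scalar_map] at hc'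
  obtain ⟨z, -, hz⟩ := hc'
  have e : σ (single i j a) = scalar ι z - single i j a := by
    rw [hz, hadd, hone]; abel
  rw [e] at hsq ⊢
  rw [eq_zero_of_scalar_sub_single_sq h hsq, map_zero, zero_sub]

theorem involution_single_of_norm (hadd : ∀ x y, σ (x + y) = σ x + σ y)
    (hmul : ∀ x y, σ (x * y) = σ y * σ x) (hone : σ 1 = 1) {i j : ι} (h : i ≠ j) (a : D)
    (hc : (1 + single i j a) * σ (1 + single i j a) ∈ Subring.center (Matrix ι ι D)) :
    σ (single i j a) = - single i j a := by
  have hsq := involution_single_sq hadd hmul h a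
  rw [subringCenter_eq_scalar_map] at hc
  obtain ⟨z, -, hz⟩ := hc
  have e : σ (single i j a) = scalar ι (z - 1) - single i j (a * z) := by
    have h1 : (1 - single i j a) * (1 + single i j a) = (1 : Matrix ι ι D) :=
      (transvectionUnit h a).inv_mul
    have h2 : 1 + σ (single i j a) = (1 - single i j a) * scalar ι z := by
      have hz' : scalar ι z = (1 + single i j a) * σ (1 + single i j a) := hz
      rw [hz', ← mul_assoc, h1, one_mul, hadd, hone]
    have h3 : single i j a * scalar ι z = single i j (a * z) := by
      ext p q
      rw [scalar_apply, mul_diagonal, single_apply, single_apply, ite_mul, zero_mul]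
    rw [eq_sub_of_add_eq' h2, sub_mul, one_mul, h3, map_sub, map_one]
    abel
  rw [e] at hsq ⊢
  have hz1 := eq_zero_of_scalar_sub_single_sq h hsq
  rw [hz1, map_zero, zero_sub, sub_eq_zero.mp hz1, mul_one]

theorem trace_mem_center_of_involution_single [Nontrivial ι]
    (hadd : ∀ x y, σ (x + y) = σ x + σ y) (hmul : ∀ x y, σ (x * y) = σ y * σ x)
    (hneg : ∀ (i j : ι), i ≠ j → ∀ a : D, σ (single i j a) = - single i j a)
    (x : Matrix ι ι D) : x + σ x ∈ Subring.center (Matrix ι ι D) := by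
  have h0 : σ 0 = 0 := by simpa using hadd 0 0
  have htwo : ∀ i j k : ι, i ≠ j → k = i ∨ k = j := by
    intro i j k hij
    by_contra! hk
    have h1 := hmul (single i j 1) (single j k 1)
    rw [single_mul_single_same, hneg i k hk.1.symm, hneg j k hk.2.symm, hneg i j hij, neg_mul_neg,
      single_mul_single_of_ne _ _ _ _ hk.1, neg_eq_zero, mul_one] at h1
    have := congrFun (congrFun h1 i) k
    simp at this
  have hdiag : ∀ i j : ι, i ≠ j → ∀ a b : D, σ (single i i (a * b)) = single j j (b * a) := by
    intro i j hij a b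
    have h1 := hmul (single i j a) (single j i b)
    rwa [single_mul_single_same, hneg j i hij.symm, hneg i j hij, neg_mul_neg,
      single_mul_single_same] at h1
  obtain ⟨i₀, j₀, hij₀⟩ := exists_pair_ne ι
  have hcomm : ∀ a b : D, a * b = b * a := by
    intro a b
    have h1 := hdiag i₀ j₀ hij₀ a b
    have h2 := hdiag i₀ j₀ hij₀ (a * b) 1
    rw [mul_one, one_mul, h1] at h2
    simpa using (congrFun (congrFun h2 j₀) j₀).symm
  induction x using Matrix.induction_on' with
  | h_zero => simp [h0]
  | h_add p q hp hq =>
    have e : p + q + σ (p + q) = (p + σ p) + (q + σ q) := by rw [hadd]; abel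
    rw [e]; exact Subring.add_mem _ hp hq
  | h_std_basis i j a =>
    rcases eq_or_ne i j with rfl | hij
    · obtain ⟨j, hj⟩ := exists_ne i
      have h1 := hdiag i j hj.symm a 1
      rw [mul_one, one_mul] at h1
      have e : single i i a + σ (single i i a) = scalar ι a := by
        rw [h1]
        ext p q
        rcases htwo i j p hj.symm with rfl | rfl <;> rcases htwo _ _ q hj.symm with rfl | rfl <;>
          simp [scalar_apply, hj, hj.symm]
      rw [e, subringCenter_eq_scalar_map]
      exact ⟨a, Subring.mem_center_iff.mpr fun b => hcomm b a, rfl⟩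
    · rw [hneg i j hij, add_neg_cancel]; exact Subring.zero_mem _

end matrixInvolutions

theorem exists_central_sq_ne_one {D : Type*} [DivisionRing D]
    (hF : (4 : Cardinal) ≤ Cardinal.mk (Subring.center D)) :
    ∃ s ∈ Subring.center D, s ≠ 0 ∧ s * s ≠ 1 := by
  classical
  by_contra! h
  have hsub : (Subring.center D : Set D) ⊆ (({0, 1, -1} : Finset D) : Set D) := by
    intro s hs
    by_cases h0 : s = 0
    · simp [h0]
    · rcases mul_self_eq_one_iff.mp (h s hs h0) with h1 | h1 <;> simp [h1]
  have h1 := hF.trans (Cardinal.mk_le_mk_of_subset hsub)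
  rw [Finset.coe_sort_coe, Cardinal.mk_coe_finset] at h1
  have h2 : 4 ≤ ({0, 1, -1} : Finset D).card := by exact_mod_cast h1
  have h3 := Finset.card_le_three (a := (0 : D)) (b := 1) (c := -1)
  omega

theorem exists_subnormalDepth_of_chain {Γ : Type*} [Group Γ] (r : ℕ)
    (c : Fin (r + 1) → Subgroup Γ) (hlast : c (Fin.last r) = ⊤)
    (hc : ∀ i : Fin r, c i.castSucc ≤ c i.succ ∧
      ∀ h ∈ c i.castSucc, ∀ g ∈ c i.succ, g * h * g⁻¹ ∈ c i.castSucc) :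
    SubnormalDepth r (c 0) := by
  induction r with
  | zero => exact hlast
  | succ r ih =>
    have h0 := hc 0
    refine ⟨c (Fin.succ 0), ih (fun i => c i.succ) hlast fun i => ?_, h0.1, h0.2⟩
    simpa using hc i.succ

theorem isUnit_or_eq_zero_of_unique {ι D : Type*} [Fintype ι] [DecidableEq ι] [Unique ι]
    [DivisionRing D] (x : Matrix ι ι D) : IsUnit x ∨ x = 0 := by
  by_cases h : x default default = 0
  · right
    ext i j
    rw [Unique.eq_default i, Unique.eq_default j, h, Matrix.zero_apply]
  · left
    refine ⟨⟨x, Matrix.of fun _ _ => (x default default)⁻¹, ?_, ?_⟩, rfl⟩ <;> ext i j <;>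
      simp [Unique.eq_default i, Unique.eq_default j, Matrix.mul_apply, Matrix.one_apply, h]

theorem norm_mem_center_of_isUnit_or_eq_zero {A : Type*} [Ring A] [Nontrivial A]
    (hA : ∀ x : A, IsUnit x ∨ x = 0) {σ : A → A}
    (hmul : ∀ x y, σ (x * y) = σ y * σ x) (h0 : ∀ x, σ x = 0 ↔ x = 0) {r : ℕ} {G : Subgroup Aˣ}
    (hG : SubnormalDepth r G) (hGc : ¬ G ≤ Subgroup.center Aˣ) :
    ((∀ g ∈ G, (g : A) + σ g ∈ Subring.center A) → ∀ g ∈ G, (g : A) * σ g ∈ Subring.center A) ∧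
    ((∀ g ∈ G, (g : A) * σ g ∈ Subring.center A) → ∀ x, x * σ x ∈ Subring.center A) := by
  let _ : DivisionRing A := DivisionRing.ofIsUnitOrEqZero hA
  exact ⟨hG.norm_mem_center_of_trace hGc hmul fun x => (h0 x).mp, hG.norm_mem_center hGc hmul h0⟩

set_option maxHeartbeats 1000000 in
set_option synthInstance.maxHeartbeats 400000 in
/-- Let `D` be a division ring whose center `F` has at least four
elements, `n` a positive integer, `σ` an involution of the first kind on
`A = M_n(D)`, and `G` a non-central subnormal subgroup of `GL_n(D) = Aˣ`. Then the
following are equivalent: (1) `g + σ g` central for all `g ∈ G`; (2) `x + σ x`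
central for all `x ∈ A`; (3) `x * σ x` central for all `x ∈ A`; (4) `g * σ g`
central for all `g ∈ G`. -/
theorem traces_norms_central_tfae (D : Type*) [DivisionRing D]
    (hF : (4 : Cardinal) ≤ Cardinal.mk (Subring.center D))
    (n : ℕ) (hn : 0 < n)
    (σ : Matrix (Fin n) (Fin n) D → Matrix (Fin n) (Fin n) D)
    (hadd : ∀ x y, σ (x + y) = σ x + σ y)
    (hmul : ∀ x y, σ (x * y) = σ y * σ x)
    (hinvo : ∀ x, σ (σ x) = x)
    (hfirst : ∀ x ∈ Subring.center (Matrix (Fin n) (Fin n) D), σ x = x)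
    (G : Subgroup (Matrix (Fin n) (Fin n) D)ˣ) (hsub : G.IsSubnormal')
    (hnc : ¬ G ≤ Subgroup.center (Matrix (Fin n) (Fin n) D)ˣ) :
    [∀ g ∈ G, g.val + σ g.val ∈ Subring.center (Matrix (Fin n) (Fin n) D),
     ∀ x : Matrix (Fin n) (Fin n) D, x + σ x ∈ Subring.center (Matrix (Fin n) (Fin n) D),
     ∀ x : Matrix (Fin n) (Fin n) D, x * σ x ∈ Subring.center (Matrix (Fin n) (Fin n) D),
     ∀ g ∈ G, g.val * σ g.val ∈ Subring.center (Matrix (Fin n) (Fin n) D)].TFAE := by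
  have hone : σ 1 = 1 := hfirst 1 (Subring.one_mem _)
  have hzero : σ 0 = 0 := hfirst 0 (Subring.zero_mem _)
  obtain ⟨r, c, rfl, hlast, hc⟩ := hsub
  have hG := exists_subnormalDepth_of_chain r c hlast hc
  tfae_have 2 → 1 := fun h g _ => h g
  tfae_have 3 → 4 := fun h g _ => h g
  tfae_have 2 → 3 := norm_mem_center_of_trace_mem_center hmul
  tfae_have 3 → 2 := trace_mem_center_of_norm_mem_center hadd hone
  obtain rfl | hn1 : n = 1 ∨ 1 < n := by omega
  · have h0 : ∀ x, σ x = 0 ↔ x = 0 := fun x =>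
      ⟨fun h => by rw [← hinvo x, h, hzero], fun h => by rw [h, hzero]⟩
    obtain ⟨h14, h43⟩ := norm_mem_center_of_isUnit_or_eq_zero isUnit_or_eq_zero_of_unique
      hmul h0 hG hnc
    tfae_have 1 → 4 := h14
    tfae_have 4 → 3 := h43
    tfae_finish
  · have : Nontrivial (Fin n) := Fin.nontrivial_iff_two_le.mpr hn1
    obtain ⟨s, hs, hs0, hs1⟩ := exists_central_sq_ne_one hF
    have hT := hG.transvectionUnits_subset hnc hs hs0 hs1
    tfae_have 1 → 2 := fun h => trace_mem_center_of_involution_single hadd hmul fun i j hij a =>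
      involution_single_of_trace hadd hmul hone hij a (h _ (hT ⟨i, j, hij, a, rfl⟩))
    tfae_have 4 → 2 := fun h => trace_mem_center_of_involution_single hadd hmul fun i j hij a =>
      involution_single_of_norm hadd hmul hone hij a (h _ (hT ⟨i, j, hij, a, rfl⟩))
    tfae_finish
end

section
/- Let D be a division ring whose center F contains at least four elements, let n be a positive integer, let ⋆ be an involution of the first kind on A = M_n(D), and let G be a non-central subnormal subgroup of GL_n(D). If x + x^⋆ lies in the center of A for every x ∈ A, then either (i) n = 1 and D is a quaternion division algebra over F (i.e., dim_F D = 4), or (ii) n = 2, D is commutative (D = F), and ⋆ is the ordinary symplectic involution on M_2(F), i.e., M^⋆ = adjugate M for every M. -/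
/-- The polarized quadratic relation satisfied by an anti-multiplicative map with central
traces. -/
theorem polar_mem_center_of_add_star_mem_center {A : Type*} [Ring A] (σ : A → A)
    (hmul : ∀ x y, σ (x * y) = σ y * σ x) (htr : ∀ x, x + σ x ∈ Subring.center A) (x y : A) :
    x * y + y * x - (y + σ y) * x - (x + σ x) * y ∈ Subring.center A := by
  have h : x * y + y * x - (y + σ y) * x - (x + σ x) * y =
      x * y + σ (x * y) - (x + σ x) * (y + σ y) := by
    have h1 := Subring.mem_center_iff.1 (htr x) (σ y)
    rw [hmul, mul_add (x + σ x), ← h1]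
    simp only [add_mul, mul_add]
    abel
  rw [h]
  exact sub_mem (htr _) (mul_mem (htr _) (htr _))


/-- If `x + σ x` is always central and the ring is not commutative, then `x * σ x` is always
central. -/
theorem mul_star_mem_center_of_add_star_mem_center {A : Type*} [Ring A]
    (hfield : IsField (Subring.center A)) (σ : A → A)
    (hmul : ∀ x y, σ (x * y) = σ y * σ x)
    (htr : ∀ x, x + σ x ∈ Subring.center A) (hone : σ 1 = 1)
    (hnc : ∃ a b : A, a * b ≠ b * a) (x : A) :
    x * σ x ∈ Subring.center A := by
  obtain ⟨t, ht⟩ : ∃ t : A → A, ∀ x, t x = x + σ x := ⟨_, fun _ => rfl⟩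
  have hs : ∀ x, σ x = t x - x := fun x => by rw [ht]; abel
  have htc : ∀ x, t x ∈ Subring.center A := fun x => ht x ▸ htr x
  have hcomm : ∀ x y, y * t x = t x * y := fun x y => Subring.mem_center_iff.1 (htc x) y
  have key : ∀ x y, x * y + y * x = t y * x + t x * y + (t (x * y) - t x * t y) := by
    intro x y
    have h := hmul x y
    rw [hs, hs, hs, sub_mul, mul_sub, mul_sub, hcomm x y, hcomm x (t y)] at h
    rw [sub_eq_iff_eq_add.1 h]
    abel
  obtain ⟨z, hz⟩ : ∃ z, t z ≠ 0 := by
    by_contra! h0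
    obtain ⟨a, b, hab⟩ := hnc
    have hneg : ∀ x, σ x = -x := fun x => by rw [hs, h0, zero_sub]
    have h1 : ∀ x : A, -x = x := fun x => by
      have h2 : (-1 : A) = 1 := by rw [← hneg, hone]
      rw [← neg_one_mul, h2, one_mul]
    have h := hmul a b
    rw [hneg, hneg, hneg, neg_mul_neg, h1] at h
    exact hab h
  have hprod : t z * (x * σ x) ∈ Subring.center A := by
    have h1 := congrArg (x * ·) (key x z)
    have h2 := key x (x * z)
    simp only [mul_add, mul_sub] at h1
    have h3 : t z * (x * σ x) = -(t (x * (x * z)) - t x * t (x * z)) := by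
      have e1 : x * (t z * x) = t z * (x * x) := by rw [← mul_assoc, hcomm, mul_assoc]
      have e2 : x * (t x * z) = t x * (x * z) := by rw [← mul_assoc, hcomm, mul_assoc]
      have e3 : x * (t x * t z) = t z * (t x * x) := by
        rw [← mul_assoc, hcomm z, hcomm x x]
      rw [e1, e2, e3, hcomm (x * z) x, ← mul_assoc x z x, h2] at h1
      rw [hs, mul_sub, mul_sub, hcomm x x]
      rw [← sub_eq_zero] at h1 ⊢
      rw [← h1]
      abel
    rw [h3]
    exact neg_mem (sub_mem (htc _) (mul_mem (htc _) (htc _)))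
  obtain ⟨w, hw⟩ := hfield.mul_inv_cancel (a := (⟨t z, htc z⟩ : Subring.center A))
    (fun h => hz (congrArg Subtype.val h))
  have hw' : t z * (w : A) = 1 := congrArg Subtype.val hw
  have : x * σ x = (w : A) * (t z * (x * σ x)) := by
    rw [← mul_assoc, hcomm, hw', one_mul]
  rw [this]
  exact mul_mem w.2 hprod

/-- A division ring with a map `σ` for which `x + σ x`, `x * σ x` and the polarizations of
`x * x - (x + σ x) * x` are central, and which moves some non-central element, has dimension four
over its center. -/
theorem finrank_center_eq_four {D : Type*} [DivisionRing D] (σ : D → D)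
    (htr : ∀ x, x + σ x ∈ Subring.center D)
    (hnorm : ∀ x, x * σ x ∈ Subring.center D)
    (hpolar : ∀ x y, x * y + y * x - (y + σ y) * x - (x + σ x) * y ∈ Subring.center D)
    (i : D) (hi : σ i ≠ i) (hic : i ∉ Subring.center D) :
    Module.finrank (Subring.center D) D = 4 := by
  obtain ⟨t, ht⟩ : ∃ t : D → D, ∀ x, t x = x + σ x := ⟨_, fun _ => rfl⟩
  have hs : ∀ x, σ x = t x - x := fun x => by rw [ht]; abel
  have htc : ∀ x, t x ∈ Subring.center D := fun x => ht x ▸ htr x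
  have hcomm : ∀ x y, y * t x = t x * y := fun x y => Subring.mem_center_iff.1 (htc x) y
  simp only [← ht] at hpolar
  obtain ⟨s, hsdef⟩ : ∃ s, s = σ i := ⟨_, rfl⟩
  have hst : s = t i - i := hsdef ▸ hs i
  have hN : i * s ∈ Subring.center D := hsdef ▸ hnorm i
  have his : i * s = s * i := by rw [hst, mul_sub, sub_mul, hcomm]
  obtain ⟨u, hu⟩ : ∃ u, u = i - s := ⟨_, rfl⟩
  have hu0 : u ≠ 0 := by
    rw [hu, sub_ne_zero, hsdef]; exact hi.symm
  have hiu : i * u = u * i := by rw [hu, mul_sub, sub_mul, his]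
  have hii : i * i = t i * i - i * s := by rw [hst, mul_sub, hcomm]; abel
  have huu : u * u ∈ Subring.center D := by
    have h : u * u = t i * t i - (i * s + i * s + (i * s + i * s)) := by
      have h2 : t i = i + s := by rw [hst]; abel
      rw [h2, hu, mul_sub, sub_mul, sub_mul, mul_add, add_mul, add_mul, his]; abel
    rw [h]
    exact sub_mem (mul_mem (htc _) (htc _)) (by simp only [add_mem, hN])
  -- the commutant of `i` is spanned by `1` and `i`
  have hK : ∀ y, i * y = y * i → ∃ a ∈ Subring.center D, ∃ b ∈ Subring.center D,
      y = a + b * i := by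
    intro y hy
    have hp := hpolar i y
    obtain ⟨c, hc⟩ : ∃ c, c = i * y + y * i - t y * i - t i * y := ⟨_, rfl⟩
    rw [← hc] at hp
    have hcc : ∀ g, g * c = c * g := Subring.mem_center_iff.1 hp
    have h1 : y * u = t y * i + c := by
      rw [hc, hu, hst, mul_sub, mul_sub, hcomm, hy]; abel
    have h2 : (u * u) * y = -(t y * (i * s) + t y * (i * s) + c * t i)
        + (t y * t i + c + c) * i := by
      have h3 : i * u = t i * i - i * s - i * s := by
        rw [hu, mul_sub, hii]
      have h4 : c * u = c * i + c * i - c * t i := by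
        rw [hu, hst, mul_sub, mul_sub]; abel
      rw [← Subring.mem_center_iff.1 huu y, ← mul_assoc, h1, add_mul, mul_assoc, h3, h4]
      simp only [mul_sub, add_mul, mul_assoc]
      abel
    have hinv : (u * u)⁻¹ ∈ Subring.center D :=
      Subring.center.coe_inv (⟨u * u, huu⟩ : Subring.center D) ▸
        ((⟨u * u, huu⟩ : Subring.center D)⁻¹).2
    refine ⟨(u * u)⁻¹ * -(t y * (i * s) + t y * (i * s) + c * t i), ?_,
      (u * u)⁻¹ * (t y * t i + c + c), ?_, ?_⟩
    · exact mul_mem hinv (neg_mem (add_mem (add_mem (mul_mem (htc _) hN) (mul_mem (htc _) hN))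
        (mul_mem hp (htc _))))
    · exact mul_mem hinv (add_mem (add_mem (mul_mem (htc _) (htc _)) hp) hp)
    · rw [mul_assoc, ← mul_add, ← h2, inv_mul_cancel_left₀ (mul_ne_zero hu0 hu0)]
  have hcs : ∀ x, (i * x - x * i) * i = s * (i * x - x * i) := by
    intro x
    have h : i * i * x = x * (i * i) + t i * (i * x - x * i) := by
      rw [hii, sub_mul, mul_sub, Subring.mem_center_iff.1 hN x, ← mul_assoc x, hcomm i x, mul_sub]
      simp only [mul_assoc]
      abel
    rw [hst, sub_mul (t i), mul_sub i, ← mul_assoc i i, h, sub_mul]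
    simp only [mul_assoc]
    abel
  obtain ⟨x₀, hx₀⟩ : ∃ x₀, i * x₀ - x₀ * i ≠ 0 := by
    by_contra! h
    exact hic (Subring.mem_center_iff.2 fun g => (sub_eq_zero.1 (h g)).symm)
  obtain ⟨j, hj⟩ : ∃ j, j = i * x₀ - x₀ * i := ⟨_, rfl⟩
  rw [← hj] at hx₀
  have hji : j * i = s * j := hj ▸ hcs x₀
  have hij : i * j = j * s := by
    have h : (i + s) * j = j * (i + s) := by
      have : i + s = t i := by rw [hst]; abel
      rw [this, hcomm]
    rw [add_mul, mul_add, ← hji, add_comm (j * i)] at h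
    exact add_right_cancel h
  have hbr : ∀ q, i * q = q * i → i * (j * q) - j * q * i = -(j * (q * u)) := by
    intro q hq
    have hsq : s * q = q * s := by rw [hst, sub_mul, mul_sub, hcomm, hq]
    rw [← mul_assoc, hij, mul_assoc, hsq, hu, mul_sub, mul_sub, mul_assoc]
    abel
  have hKc : ∀ a b : Subring.center D, i * ((a : D) + b * i) = ((a : D) + b * i) * i := by
    intro a b
    rw [mul_add, add_mul, Subring.mem_center_iff.1 a.2 i, ← mul_assoc,
      Subring.mem_center_iff.1 b.2 i]
  have hzero : ∀ a b : Subring.center D, (a : D) + b * i = 0 → a = 0 ∧ b = 0 := by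
    intro a b h
    have hb : b = 0 := by
      by_contra hb
      have hb' : (b : D) ≠ 0 := fun h => hb (Subtype.ext h)
      apply hic
      have : i = ((b⁻¹ * -a : Subring.center D) : D) := by
        rw [Subring.coe_mul, Subring.center.coe_inv, Subring.coe_neg, ← eq_neg_of_add_eq_zero_right h,
          inv_mul_cancel_left₀ hb']
      rw [this]
      exact Subtype.property _
    subst hb
    exact ⟨Subtype.ext (by simpa using h), rfl⟩
  let F := Subring.center D
  let f : (F × F × F × F) →ₗ[F] D :=
    { toFun := fun p => (p.1 + p.2.1 * i) + j * (p.2.2.1 + p.2.2.2 * i)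
      map_add' := fun p q => by
        simp only [Prod.fst_add, Prod.snd_add, Subring.coe_add, add_mul, mul_add]
        abel
      map_smul' := fun r p => by
        have := Subring.mem_center_iff.1 r.2 j
        simp only [Prod.smul_fst, Prod.smul_snd, smul_eq_mul, Subring.coe_mul, Subring.smul_def,
          RingHom.id_apply, mul_assoc, ← mul_add]
        rw [mul_add (r : D), ← mul_assoc j, this, mul_assoc (r : D) j]
        simp only [mul_add] }
  have hf : ∀ p, f p = (p.1 + p.2.1 * i) + j * (p.2.2.1 + p.2.2.2 * i) := fun _ => rfl
  have hbij : Function.Bijective f := by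
    constructor
    · rw [injective_iff_map_eq_zero]
      rintro ⟨a, b, c, d⟩ h
      rw [hf] at h
      have h1 := hbr _ (hKc c d)
      have hq : (c : D) + d * i = 0 := by
        have h2 : j * ((c : D) + d * i) = -((a : D) + b * i) := eq_neg_of_add_eq_zero_right h
        rw [h2, mul_neg, neg_mul, hKc, sub_self, eq_comm, neg_eq_zero] at h1
        simpa [hx₀, hu0] using h1
      have hp : (a : D) + b * i = 0 := by simpa [hq] using h
      obtain ⟨rfl, rfl⟩ := hzero _ _ hq
      obtain ⟨rfl, rfl⟩ := hzero _ _ hp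
      rfl
    · intro x
      have hu' : i * u⁻¹ = u⁻¹ * i := (Commute.inv_right₀ (show Commute i u from hiu)).eq
      obtain ⟨q, hq⟩ : ∃ q, q = -(j⁻¹ * (i * x - x * i) * u⁻¹) := ⟨_, rfl⟩
      have hjs : i * j⁻¹ = j⁻¹ * s := by
        rw [eq_inv_mul_iff_mul_eq₀ hx₀, ← mul_assoc, hji, mul_inv_cancel_right₀ hx₀]
      have hqi : i * q = q * i := by
        rw [hq, mul_neg, neg_mul, mul_assoc _ u⁻¹, ← hu', ← mul_assoc _ i u⁻¹, mul_assoc j⁻¹ _ i, hcs,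
          ← mul_assoc i, ← mul_assoc i, hjs, mul_assoc j⁻¹ s]
      have hp : i * (x - j * q) = (x - j * q) * i := by
        have h := hbr q hqi
        have hqu : j * (q * u) = -(i * x - x * i) := by
          rw [hq, neg_mul, inv_mul_cancel_right₀ hu0, mul_neg, ← mul_assoc, mul_inv_cancel₀ hx₀,
            one_mul]
        rw [hqu, neg_neg] at h
        rw [← sub_eq_zero, mul_sub, sub_mul, sub_sub_sub_comm, h, sub_self]
      obtain ⟨a, ha, b, hb, hab⟩ := hK _ hp
      obtain ⟨c, hc, d, hd, hcd⟩ := hK _ hqi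
      refine ⟨(⟨a, ha⟩, ⟨b, hb⟩, ⟨c, hc⟩, ⟨d, hd⟩), ?_⟩
      rw [hf]
      simp only [← hab, ← hcd, sub_add_cancel]
  rw [← (LinearEquiv.ofBijective f hbij).finrank_eq]
  simp [Module.finrank_prod]


/-- Let `D` be a division ring whose center `F` has at least four
elements, `n` a positive integer, `σ` an involution of the first kind on
`A = M_n(D)`, and `G` a non-central subnormal subgroup of `GL_n(D)`. If `x + σ x`
is central for every `x ∈ A`, then either (i) `n = 1` and `D` is a quaternion
division algebra over `F` (`dim_F D = 4`), or (ii) `n = 2`, `D` is commutative and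
`σ` is the ordinary symplectic involution, i.e. the adjugate map (for `2 × 2`
matrices, `adjugate M = (trace M) • 1 - M`). -/
theorem symplectic_matrix_classification (D : Type*) [DivisionRing D]
    (hF : (4 : Cardinal) ≤ Cardinal.mk (Subring.center D))
    (n : ℕ) (hn : 0 < n)
    (σ : Matrix (Fin n) (Fin n) D → Matrix (Fin n) (Fin n) D)
    (hadd : ∀ x y, σ (x + y) = σ x + σ y)
    (hmul : ∀ x y, σ (x * y) = σ y * σ x)
    (hinvo : ∀ x, σ (σ x) = x)
    (hfirst : ∀ x ∈ Subring.center (Matrix (Fin n) (Fin n) D), σ x = x)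
    (G : Subgroup (Matrix (Fin n) (Fin n) D)ˣ) (hsub : G.IsSubnormal')
    (hnc : ¬ G ≤ Subgroup.center (Matrix (Fin n) (Fin n) D)ˣ)
    (htr : ∀ x : Matrix (Fin n) (Fin n) D,
      x + σ x ∈ Subring.center (Matrix (Fin n) (Fin n) D)) :
    (n = 1 ∧ Module.finrank (Subring.center D) D = 4) ∨
    (n = 2 ∧ (∀ a b : D, a * b = b * a) ∧
      ∀ M : Matrix (Fin n) (Fin n) D,
        σ M = Matrix.trace M • (1 : Matrix (Fin n) (Fin n) D) - M) := by
  have hone : σ 1 = 1 := hfirst 1 (one_mem _)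
  have hcomm : ∃ a b : Matrix (Fin n) (Fin n) D, a * b ≠ b * a := by
    by_contra! h
    exact hnc fun g _ => Subgroup.mem_center_iff.2 fun k => Units.ext (h _ _)
  have : NeZero n := ⟨hn.ne'⟩
  have hnorm := mul_star_mem_center_of_add_star_mem_center (IsSimpleRing.isField_center _) σ hmul
    htr hone hcomm
  have hentry : ∀ x : Matrix (Fin n) (Fin n) D, ∃ d ∈ Subring.center D, ∃ c : D,
      σ x = d • 1 - x ∧ ∀ k l, (x * x) k l = d * x k l - if k = l then c else 0 := by
    intro x
    have h1 := htr x
    have h2 := hnorm x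
    rw [Matrix.subringCenter_eq_scalar_map, Subring.mem_map] at h1 h2
    obtain ⟨d, hd, hdx⟩ := h1
    obtain ⟨c, -, hcx⟩ := h2
    refine ⟨d, hd, c, ?_, fun k l => ?_⟩
    · rw [Matrix.smul_one_eq_diagonal, ← Matrix.scalar_apply, hdx]
      abel
    · have h : x * x = Matrix.scalar (Fin n) d * x - Matrix.scalar (Fin n) c := by
        rw [hcx, hdx, ← Subring.mem_center_iff.1 (htr x) x, mul_add]
        abel
      rw [h, Matrix.sub_apply, Matrix.scalar_apply, Matrix.scalar_apply, Matrix.diagonal_mul,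
        Matrix.diagonal_apply]
  match n, hn with
  | 1, _ =>
    refine Or.inl ⟨rfl, ?_⟩
    let e : Matrix (Fin 1) (Fin 1) D ≃+* D := Matrix.uniqueRingEquiv
    have he : ∀ z ∈ Subring.center (Matrix (Fin 1) (Fin 1) D), e z ∈ Subring.center D := by
      intro z hz
      refine Subring.mem_center_iff.2 fun g => ?_
      have := congrArg e (Subring.mem_center_iff.1 hz (e.symm g))
      simpa using this
    obtain ⟨i, hi⟩ : ∃ i, σ i ≠ i := by
      by_contra! h
      obtain ⟨a, b, hab⟩ := hcomm
      exact hab (by rw [← h (a * b), hmul, h, h])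
    refine finrank_center_eq_four (fun d => e (σ (e.symm d))) (fun x => ?_) (fun x => ?_)
      (fun x y => ?_) (e i) (fun h => hi ?_) (fun h => hi (hfirst i ?_))
    · simpa using he _ (htr (e.symm x))
    · simpa using he _ (hnorm (e.symm x))
    · simpa using he _ (polar_mem_center_of_add_star_mem_center σ hmul htr (e.symm x) (e.symm y))
    · simpa using h
    · refine Subring.mem_center_iff.2 fun g => e.injective ?_
      rw [map_mul, map_mul, Subring.mem_center_iff.1 h]
  | 2, _ =>
    have hD : ∀ a : D, a ∈ Subring.center D := by
      intro a
      by_cases ha : a = 0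
      · rw [ha]; exact zero_mem _
      obtain ⟨d, hd, c, -, h⟩ := hentry !![a, 0; 0, 0]
      have h1 := h 1 1
      have h0 := h 0 0
      simp [Matrix.mul_apply] at h0 h1
      rw [h1, sub_zero] at h0
      rwa [mul_right_cancel₀ ha h0]
    refine Or.inr ⟨rfl, fun a b => Subring.mem_center_iff.1 (hD b) a, fun M => ?_⟩
    by_cases hM : M ∈ Subring.center (Matrix (Fin 2) (Fin 2) D)
    · rw [hfirst M hM]
      rw [Matrix.subringCenter_eq_scalar_map, Subring.mem_map] at hM
      obtain ⟨d, -, rfl⟩ := hM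
      ext k l
      fin_cases k <;> fin_cases l <;> simp [two_mul]
    · obtain ⟨d, hd, c, hσ, h⟩ := hentry M
      rw [hσ]
      congr 2
      have hc : ∀ a b : D, a * b = b * a := fun a b => Subring.mem_center_iff.1 (hD b) a
      have h00 := h 0 0
      have h01 := h 0 1
      have h10 := h 1 0
      have h11 := h 1 1
      simp [Matrix.mul_apply] at h00 h01 h10 h11
      rw [Matrix.trace_fin_two]
      by_contra hne
      have h01' : M 0 1 = 0 := by
        by_contra hb
        refine hne (mul_right_cancel₀ hb ?_)
        rw [← h01, add_mul, hc (M 0 1)]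
      have h10' : M 1 0 = 0 := by
        by_contra hb
        refine hne (mul_right_cancel₀ hb ?_)
        rw [← h10, add_mul, hc (M 1 0), add_comm]
      have hdiag : M 0 0 = M 1 1 := by
        by_contra hb
        refine hne (mul_right_cancel₀ (sub_ne_zero.2 hb) ?_)
        rw [h01', zero_mul, add_zero, eq_sub_iff_add_eq] at h00
        rw [h01', mul_zero, zero_add, eq_sub_iff_add_eq] at h11
        rw [mul_sub, ← h00, ← h11, add_mul, mul_sub, mul_sub, hc (M 1 1) (M 0 0)]
        abel
      refine hM (Subring.mem_center_iff.2 fun g => ?_)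
      ext k l
      fin_cases k <;> fin_cases l <;> simp [Matrix.mul_apply, h01', h10', hdiag, hc (M 1 1)]
  | m + 3, _ =>
    exfalso
    obtain ⟨d, hd, c, -, h⟩ := hentry (Matrix.single 0 1 1 + Matrix.single 1 2 1)
    have h02 := h 0 2
    have e1 : (1 : Fin (m + 3)) ≠ 0 := by simp
    have hm : 2 % (m + 3) = 2 := Nat.mod_eq_of_lt (by omega)
    have e2 : (2 : Fin (m + 3)) ≠ 0 := by simp [Fin.ext_iff, hm]
    have e3 : (2 : Fin (m + 3)) ≠ 1 := by simp [Fin.ext_iff, hm]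
    simp [add_mul, mul_add, e1, e2, e3, e2.symm, e3.symm] at h02
end
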